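/- arXiv:2007.08810 — 11 statements merged into one kernel-verified Lean document; each statement's English description precedes it below -/
import Mathlib

section
/- Let f : ℝ^d → ℝ be C¹, let δ, θ ∈ (0,1), C > 0, γ > 0, and let x, y, x* ∈ ℝ^d. Suppose (a) f(x) ≥ f(x*) and f(y) ≥ f(x*); (b) f(y) ≤ f(x) − (δ/γ)‖y − x‖²; (c) ‖∇f(x)‖ ≤ (1/γ)‖y − x‖; (d) C(f(x) − f(x*))^θ ≤ ‖∇f(x)‖. Then δC(1−θ)‖y − x‖ ≤ (f(x) − f(x*))^{1−θ} − (f(y) − f(x*))^{1−θ}. -/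
/-- Concavity of `t ↦ t ^ (1 - θ)`, with the tangent slope at `a` cleared of its denominator. -/
theorem one_sub_mul_sub_le_rpow_mul_rpow_sub {a b θ : ℝ} (ha : 0 ≤ a) (hb : 0 ≤ b)
    (hθ0 : 0 ≤ θ) (hθ1 : θ ≤ 1) :
    (1 - θ) * (a - b) ≤ a ^ θ * (a ^ (1 - θ) - b ^ (1 - θ)) := by
  have amgm := Real.geom_mean_le_arith_mean2_weighted hθ0 (sub_nonneg.2 hθ1) ha hb (by ring)
  have hmul : a ^ θ * a ^ (1 - θ) = a := by
    rw [← Real.rpow_add' ha (by norm_num)]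
    norm_num
  linarith

/-- **Controlled descent lemma.** -/
theorem controlled_descent {d : ℕ}
    (f : EuclideanSpace ℝ (Fin d) → ℝ) (hf : ContDiff ℝ 1 f)
    (δ θ : ℝ) (hδ : δ ∈ Set.Ioo (0 : ℝ) 1) (hθ : θ ∈ Set.Ioo (0 : ℝ) 1)
    (C : ℝ) (hC : 0 < C) (γ : ℝ) (hγ : 0 < γ)
    (x y xs : EuclideanSpace ℝ (Fin d))
    (ha1 : f xs ≤ f x) (ha2 : f xs ≤ f y)
    (hb : f y ≤ f x - (δ / γ) * ‖y - x‖ ^ 2)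
    (hc : ‖gradient f x‖ ≤ (1 / γ) * ‖y - x‖)
    (hd : C * (f x - f xs) ^ θ ≤ ‖gradient f x‖) :
    δ * C * (1 - θ) * ‖y - x‖
      ≤ (f x - f xs) ^ (1 - θ) - (f y - f xs) ^ (1 - θ) := by
  obtain ⟨hδ0, -⟩ := hδ
  obtain ⟨hθ0, hθ1⟩ := hθ
  have hδγ : 0 < δ / γ := div_pos hδ0 hγ
  rcases ha1.eq_or_lt with h | h
  · have hsq : ‖y - x‖ ^ 2 = 0 :=
      le_antisymm (nonpos_of_mul_nonpos_right (by linarith) hδγ) (sq_nonneg _)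
    have hyx : y = x := sub_eq_zero.1 (norm_eq_zero.1 (pow_eq_zero_iff two_ne_zero |>.1 hsq))
    simp [hyx]
  · have hpos : 0 < (f x - f xs) ^ θ := Real.rpow_pos_of_pos (sub_pos.2 h) θ
    refine le_of_mul_le_mul_left ?_ hpos
    calc (f x - f xs) ^ θ * (δ * C * (1 - θ) * ‖y - x‖)
        = (1 - θ) * (δ * ‖y - x‖ * (C * (f x - f xs) ^ θ)) := by ring
      _ ≤ (1 - θ) * (δ * ‖y - x‖ * ((1 / γ) * ‖y - x‖)) := by
          have := sub_pos.2 hθ1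
          gcongr (1 - θ) * (δ * ‖y - x‖ * ?_)
          exact hd.trans hc
      _ = (1 - θ) * ((δ / γ) * ‖y - x‖ ^ 2) := by ring
      _ ≤ (1 - θ) * ((f x - f xs) - (f y - f xs)) :=
          mul_le_mul_of_nonneg_left (by linarith) (sub_nonneg.2 hθ1.le)
      _ ≤ _ := one_sub_mul_sub_le_rpow_mul_rpow_sub (sub_nonneg.2 ha1) (sub_nonneg.2 ha2)
          hθ0.le hθ1.le
end

section
/- Let f : ℝ^d → ℝ be C¹, δ ∈ (0,1), and let (x_n) in ℝ^d and (γ_n) in (0,∞) satisfy, for all n: f(x_{n+1}) ≤ f(x_n) − (δ/γ_n)‖x_{n+1} − x_n‖² and ‖∇f(x_n)‖ ≤ (1/γ_n)‖x_{n+1} − x_n‖. If x* ∈ ℝ^d is a cluster point of (x_n) and f satisfies the Łojasiewicz inequality at x* with some constants η, C > 0 and exponent θ ∈ (0,1), then the series Σ_n ‖x_{n+1} − x_n‖ converges and the whole sequence (x_n) converges to x*. -/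
/-- One step of a Łojasiewicz descent: a decrease of `f`-values by at least `c * a ^ θ * s`
bounds the step `s` by the decrease of `a ^ (1 - θ)`. -/
theorem step_le_of_lojasiewicz_descent {a b s c θ : ℝ} (ha : 0 < a) (hb : 0 ≤ b) (hc : 0 < c)
    (hθ : θ ∈ Set.Ioo (0 : ℝ) 1) (h : c * a ^ θ * s ≤ a - b) :
    s ≤ 1 / (c * (1 - θ)) * a ^ (1 - θ) - 1 / (c * (1 - θ)) * b ^ (1 - θ) := by
  have hθ' : 0 < 1 - θ := sub_pos.2 hθ.2
  have hpos : 0 < a ^ θ := Real.rpow_pos_of_pos ha θ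
  have amgm : b ^ (1 - θ) * a ^ θ ≤ (1 - θ) * b + θ * a :=
    Real.geom_mean_le_arith_mean2_weighted hθ'.le hθ.1.le hb ha.le (by ring)
  have hmul : a ^ (1 - θ) * a ^ θ = a := by
    rw [← Real.rpow_add ha, sub_add_cancel, Real.rpow_one]
  rw [← mul_sub, one_div_mul_eq_div, le_div_iff₀ (mul_pos hc hθ')]
  refine le_of_mul_le_mul_right ?_ hpos
  have h' := mul_le_mul_of_nonneg_left h hθ'.le
  nlinarith

/-- If the steps of a sequence are bounded, within a ball, by the decrements of a nonnegative
quantity `g`, and along a subsequence `x` tends to the centre and `g` tends to zero, then the steps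
are summable and the sequence converges to the centre. -/
theorem summable_dist_and_tendsto_of_dist_le_sub {X : Type*} [PseudoMetricSpace X]
    {x : ℕ → X} {z : X} {g : ℕ → ℝ} {η : ℝ} {φ : ℕ → ℕ} (hη : 0 < η) (hg : ∀ n, 0 ≤ g n)
    (hstep : ∀ n, x n ∈ Metric.ball z η → dist (x (n + 1)) (x n) ≤ g n - g (n + 1))
    (hx : Filter.Tendsto (x ∘ φ) Filter.atTop (nhds z))
    (hgφ : Filter.Tendsto (g ∘ φ) Filter.atTop (nhds 0)) :
    Summable (fun n => dist (x (n + 1)) (x n)) ∧ Filter.Tendsto x Filter.atTop (nhds z) := by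
  have htrap : ∀ ε > 0, ε ≤ η → ∃ N, ∀ n ≥ N, dist (x n) z < ε := by
    intro ε hε hεη
    have hlim : Filter.Tendsto (fun k => dist (x (φ k)) z + g (φ k)) Filter.atTop (nhds 0) := by
      simpa using (tendsto_iff_dist_tendsto_zero.1 hx).add hgφ
    obtain ⟨k, hk⟩ := (hlim.eventually_lt_const hε).exists
    refine ⟨φ k, fun n hn => ?_⟩
    suffices dist (x n) z + g n < ε by linarith [hg n]
    induction n, hn using Nat.le_induction with
    | base => exact hk
    | succ n _ ih =>
      have hball : x n ∈ Metric.ball z η := by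
        rw [Metric.mem_ball]
        linarith [hg n]
      linarith [hstep n hball, dist_triangle (x (n + 1)) (x n) z]
  constructor
  · obtain ⟨N, hN⟩ := htrap η hη le_rfl
    rw [← summable_nat_add_iff N]
    refine summable_of_sum_range_le (c := g N) (fun _ => dist_nonneg) fun m => ?_
    calc ∑ i ∈ Finset.range m, dist (x (i + N + 1)) (x (i + N))
        ≤ ∑ i ∈ Finset.range m, (g (i + N) - g (i + 1 + N)) :=
          Finset.sum_le_sum fun i _ => by
            rw [add_right_comm i 1 N]
            exact hstep _ (Metric.mem_ball.2 (hN _ (Nat.le_add_left N i)))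
      _ = g (0 + N) - g (m + N) := Finset.sum_range_sub' (fun i => g (i + N)) m
      _ ≤ g N := by simpa using hg (m + N)
  · rw [Metric.tendsto_atTop]
    intro ε hε
    obtain ⟨N, hN⟩ := htrap (min ε η) (lt_min hε hη) (min_le_right _ _)
    exact ⟨N, fun n hn => (hN n hn).trans_le (min_le_left _ _)⟩

/-- **Convergence recipe.** Under the descent conditions, if `x*` is a cluster point of the
sequence and `f` satisfies the Łojasiewicz inequality at `x*`, then the increments are summable
and the whole sequence converges to `x*`. -/
theorem convergence_recipe {d : ℕ}
    (f : EuclideanSpace ℝ (Fin d) → ℝ) (hf : ContDiff ℝ 1 f)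
    (δ : ℝ) (hδ : δ ∈ Set.Ioo (0 : ℝ) 1)
    (x : ℕ → EuclideanSpace ℝ (Fin d)) (γ : ℕ → ℝ) (hγ : ∀ n, 0 < γ n)
    (hdesc : ∀ n, f (x (n + 1)) ≤ f (x n) - (δ / γ n) * ‖x (n + 1) - x n‖ ^ 2)
    (hgrad : ∀ n, ‖gradient f (x n)‖ ≤ (1 / γ n) * ‖x (n + 1) - x n‖)
    (xs : EuclideanSpace ℝ (Fin d))
    (hcluster : ∃ φ : ℕ → ℕ, StrictMono φ ∧
      Filter.Tendsto (fun n => x (φ n)) Filter.atTop (nhds xs))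
    (η C θ : ℝ) (hη : 0 < η) (hC : 0 < C) (hθ : θ ∈ Set.Ioo (0 : ℝ) 1)
    (hKL : ∀ y ∈ Metric.ball xs η, C * |f y - f xs| ^ θ ≤ ‖gradient f y‖) :
    Summable (fun n => ‖x (n + 1) - x n‖) ∧
      Filter.Tendsto x Filter.atTop (nhds xs) := by
  obtain ⟨φ, hφ, hxφ⟩ := hcluster
  have hp : 0 < 1 - θ := sub_pos.2 hθ.2
  have hanti : Antitone fun n => f (x n) := antitone_nat_of_succ_le fun n =>
    (hdesc n).trans (sub_le_self _ (mul_nonneg (div_pos hδ.1 (hγ n)).le (sq_nonneg _)))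
  have hfφ : Filter.Tendsto (fun n => f (x (φ n))) Filter.atTop (nhds (f xs)) :=
    (hf.continuous.tendsto xs).comp hxφ
  have hge : ∀ n, f xs ≤ f (x n) := fun n =>
    le_of_tendsto hfφ ((hφ.tendsto_atTop.eventually_ge_atTop n).mono fun _ hk => hanti hk)
  simp only [← dist_eq_norm]
  refine summable_dist_and_tendsto_of_dist_le_sub (φ := φ) hη
    (g := fun n => 1 / (δ * C * (1 - θ)) * (f (x n) - f xs) ^ (1 - θ)) (fun n => ?_)
    (fun n hn => ?_) hxφ ?_
  · have := hδ.1
    have := sub_nonneg.2 (hge n)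
    positivity
  · rw [dist_eq_norm]
    rcases (hge n).eq_or_lt with heq | hlt
    · have hsucc : f (x (n + 1)) = f xs := le_antisymm (heq ▸ hanti n.le_succ) (hge _)
      have hsq : ‖x (n + 1) - x n‖ ^ 2 ≤ 0 := by
        by_contra! hlt
        linarith [mul_pos (div_pos hδ.1 (hγ n)) hlt, hdesc n]
      have hzero : ‖x (n + 1) - x n‖ = 0 := pow_eq_zero_iff two_ne_zero |>.1
        (le_antisymm hsq (sq_nonneg _))
      simp only [hzero, hsucc, ← heq, sub_self, le_refl]
    · refine step_le_of_lojasiewicz_descent (sub_pos.2 hlt) (sub_nonneg.2 (hge _))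
        (mul_pos hδ.1 hC) hθ ?_
      have hKLn := hKL _ hn
      rw [abs_of_pos (sub_pos.2 hlt)] at hKLn
      calc δ * C * (f (x n) - f xs) ^ θ * ‖x (n + 1) - x n‖
          = δ * (C * (f (x n) - f xs) ^ θ) * ‖x (n + 1) - x n‖ := by ring
        _ ≤ δ * (1 / γ n * ‖x (n + 1) - x n‖) * ‖x (n + 1) - x n‖ :=
          mul_le_mul_of_nonneg_right
            (mul_le_mul_of_nonneg_left (hKLn.trans (hgrad n)) hδ.1.le) (norm_nonneg _)
        _ = δ / γ n * ‖x (n + 1) - x n‖ ^ 2 := by ring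
        _ ≤ f (x n) - f xs - (f (x (n + 1)) - f xs) := by linarith [hdesc n]
  · have hlim := ((hfφ.sub_const (f xs)).rpow_const (Or.inr hp.le)).const_mul
      (1 / (δ * C * (1 - θ)))
    rwa [sub_self, Real.zero_rpow hp.ne', mul_zero] at hlim
end

section
/- Let f : ℝ^d → ℝ be C¹ with globally (β,ν)-Hölder gradient, where β > 0 and ν ∈ (0,1], and let 0 < γ < (ν+1)/β. Set δ := 1 − γ^ν (β/(ν+1))^ν, which is positive. Then for every x ∈ ℝ^d, with step size λ(x) := γ((ν+1)/β)^{1/ν − 1}‖∇f(x)‖^{1/ν − 1}, one has f(x − λ(x)∇f(x)) ≤ f(x) − δ λ(x) ‖∇f(x)‖². -/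
/-- The Hölder descent lemma: a differentiable function whose gradient is `(β,ν)`-Hölder is
bounded above by its first-order expansion plus `β / (ν + 1) * ‖v‖ ^ (ν + 1)`. -/
theorem le_add_inner_gradient_add_of_holder {E : Type*} [NormedAddCommGroup E]
    [InnerProductSpace ℝ E] [CompleteSpace E] {f : E → ℝ} (hf : Differentiable ℝ f)
    {β ν : ℝ} (hν : 0 < ν)
    (hH : ∀ x y : E, ‖gradient f x - gradient f y‖ ≤ β * ‖x - y‖ ^ ν) (x v : E) :
    f (x + v) ≤ f x + inner ℝ (gradient f x) v + β / (ν + 1) * ‖v‖ ^ (ν + 1) := by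
  have hν1 : ν + 1 ≠ 0 := by positivity
  let φ : ℝ → ℝ := fun t ↦
    f (x + t • v) - t * inner ℝ (gradient f x) v - β / (ν + 1) * ‖v‖ ^ (ν + 1) * t ^ (ν + 1)
  have hφ (t : ℝ) : HasDerivAt φ (inner ℝ (gradient f (x + t • v)) v
      - 1 * inner ℝ (gradient f x) v
      - β / (ν + 1) * ‖v‖ ^ (ν + 1) * ((ν + 1) * t ^ (ν + 1 - 1))) t := by
    have hline : HasDerivAt (fun s : ℝ ↦ x + s • v) v t := by
      simpa using ((hasDerivAt_id t).smul_const v).const_add x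
    have hfl := (hf (x + t • v)).hasGradientAt.hasFDerivAt.comp_hasDerivAt t hline
    rw [InnerProductSpace.toDual_apply_apply] at hfl
    exact (hfl.sub ((hasDerivAt_id t).mul_const _)).sub
      ((Real.hasDerivAt_rpow_const (Or.inr (by linarith))).const_mul _)
  have hanti : AntitoneOn φ (Set.Ici 0) := by
    refine antitoneOn_of_deriv_nonpos (convex_Ici 0)
      (fun t _ ↦ (hφ t).continuousAt.continuousWithinAt)
      (fun t _ ↦ (hφ t).differentiableAt.differentiableWithinAt) fun t ht ↦ ?_
    rw [interior_Ici] at ht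
    have ht0 : 0 ≤ t := le_of_lt ht
    rw [(hφ t).deriv, one_mul, ← inner_sub_left, add_sub_cancel_right, sub_nonpos]
    calc inner ℝ (gradient f (x + t • v) - gradient f x) v
        ≤ ‖gradient f (x + t • v) - gradient f x‖ * ‖v‖ := real_inner_le_norm _ _
      _ ≤ β * ‖x + t • v - x‖ ^ ν * ‖v‖ := by gcongr; exact hH _ _
      _ = β / (ν + 1) * ‖v‖ ^ (ν + 1) * ((ν + 1) * t ^ ν) := by
        rw [add_sub_cancel_left, norm_smul, Real.norm_of_nonneg ht0,
          Real.mul_rpow ht0 (norm_nonneg v), Real.rpow_add_one' (norm_nonneg v) hν1]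
        field_simp
  have h01 := hanti (Set.mem_Ici.2 le_rfl) (Set.mem_Ici.2 zero_le_one) zero_le_one
  simp only [φ, one_smul, zero_smul, add_zero, Real.one_rpow, Real.zero_rpow hν1] at h01
  linarith

/-- **One-step descent of the Hölder gradient method.** For `f` with globally `(β,ν)`-Hölder
gradient and `0 < γ < (ν+1)/β`, the quantity `δ = 1 - γ^ν (β/(ν+1))^ν` is positive and the step
`λ(x) = γ ((ν+1)/β)^(1/ν-1) ‖∇f(x)‖^(1/ν-1)` yields a sufficient decrease. -/
theorem holder_gradient_one_step_descent {d : ℕ}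
    (f : EuclideanSpace ℝ (Fin d) → ℝ) (hf : ContDiff ℝ 1 f)
    (β ν : ℝ) (hβ : 0 < β) (hν : ν ∈ Set.Ioc (0 : ℝ) 1)
    (hH : ∀ x y : EuclideanSpace ℝ (Fin d),
      ‖gradient f x - gradient f y‖ ≤ β * ‖x - y‖ ^ ν)
    (γ : ℝ) (hγ : 0 < γ) (hγ' : γ < (ν + 1) / β)
    (δ : ℝ) (hδ : δ = 1 - γ ^ ν * (β / (ν + 1)) ^ ν) :
    0 < δ ∧
      ∀ x : EuclideanSpace ℝ (Fin d),
        f (x - (γ * ((ν + 1) / β) ^ (1 / ν - 1) * ‖gradient f x‖ ^ (1 / ν - 1)) • gradient f x)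
          ≤ f x - δ * (γ * ((ν + 1) / β) ^ (1 / ν - 1) * ‖gradient f x‖ ^ (1 / ν - 1))
              * ‖gradient f x‖ ^ 2 := by
  obtain ⟨hν0, -⟩ := hν
  have hL : 0 < (ν + 1) / β := by positivity
  have hLinv : β / (ν + 1) = ((ν + 1) / β)⁻¹ := (inv_div _ _).symm
  rw [hLinv] at hδ
  have hdesc := le_add_inner_gradient_add_of_holder (hf.differentiable one_ne_zero) hν0 hH
  rw [hLinv] at hdesc
  generalize (ν + 1) / β = L at *
  refine ⟨?_, fun x ↦ ?_⟩
  · rw [hδ, ← Real.mul_rpow hγ.le (by positivity), sub_pos]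
    refine Real.rpow_lt_one (by positivity) ?_ hν0
    rwa [← div_eq_mul_inv, div_lt_one hL]
  · rcases eq_or_ne (gradient f x) 0 with hg | hg
    · simp [hg]
    have hn : 0 < ‖gradient f x‖ := norm_pos_iff.2 hg
    set n := ‖gradient f x‖ with hn_def
    set lam := γ * L ^ (1 / ν - 1) * n ^ (1 / ν - 1) with hlam
    have hlam0 : 0 < lam := by positivity
    have hexp : (1 / ν - 1) * ν = 1 - ν := by field_simp
    have hpow : lam ^ ν = γ ^ ν * L ^ (1 - ν) * n ^ (1 - ν) := by
      rw [hlam, Real.mul_rpow (by positivity) (by positivity),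
        Real.mul_rpow hγ.le (by positivity), ← Real.rpow_mul hL.le, ← Real.rpow_mul hn.le, hexp]
    have hrem : L⁻¹ * ‖-(lam • gradient f x)‖ ^ (ν + 1) = γ ^ ν * L⁻¹ ^ ν * lam * n ^ 2 := by
      rw [norm_neg, norm_smul, Real.norm_of_nonneg hlam0.le, ← hn_def,
        Real.mul_rpow hlam0.le hn.le, Real.rpow_add_one hlam0.ne', Real.rpow_add_one hn.ne', hpow,
        Real.rpow_sub hL, Real.rpow_sub hn, Real.inv_rpow hL.le, Real.rpow_one, Real.rpow_one]
      field_simp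
    have h := hdesc x (-(lam • gradient f x))
    rw [hrem, ← sub_eq_add_neg, inner_neg_right, real_inner_smul_right,
      real_inner_self_eq_norm_sq, ← hn_def] at h
    rw [hδ]
    linarith
end

section
/- Let f : ℝ^d → ℝ be C¹ with globally (β,ν)-Hölder gradient, β > 0, ν ∈ (0,1], and let 0 < γ < (ν+1)/β. Let (x_n) be generated by the Hölder gradient method: x_{n+1} = x_n − γ_n ∇f(x_n) with γ_n = γ((ν+1)/β)^{1/ν − 1}‖∇f(x_n)‖^{1/ν − 1}. Then the sequence (f(x_n)) is nonincreasing, and if (x_n) is bounded then (f(x_n)) converges. -/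
/-- **Descent lemma** for a function with `(β, ν)`-Hölder gradient. -/
theorem le_add_inner_gradient_add_of_gradient_holder {E : Type*} [NormedAddCommGroup E]
    [InnerProductSpace ℝ E] [CompleteSpace E] {f : E → ℝ} (hf : Differentiable ℝ f) {β ν : ℝ}
    (hν : 0 ≤ ν) (hH : ∀ x y : E, ‖gradient f x - gradient f y‖ ≤ β * ‖x - y‖ ^ ν) (x v : E) :
    f (x + v) ≤ f x + inner ℝ (gradient f x) v + β / (ν + 1) * ‖v‖ ^ (ν + 1) := by
  set φ : ℝ → ℝ := fun t =>
    f (x + t • v) - t * inner ℝ (gradient f x) v - β / (ν + 1) * ‖v‖ ^ (ν + 1) * t ^ (ν + 1)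
    with hφ
  have hν1 : ν + 1 ≠ 0 := by positivity
  have hderiv (t : ℝ) : HasDerivAt φ
      (inner ℝ (gradient f (x + t • v) - gradient f x) v - β * ‖v‖ ^ (ν + 1) * t ^ ν) t := by
    have hline : HasDerivAt (fun s : ℝ => x + s • v) v t := by
      simpa using ((hasDerivAt_id t).smul_const v).const_add x
    have hcomp := (hf (x + t • v)).hasGradientAt.hasFDerivAt.comp_hasDerivAt t hline
    have hlin := (hasDerivAt_id t).mul_const (inner ℝ (gradient f x) v)
    have hpow := ((Real.hasDerivAt_rpow_const (x := t) (p := ν + 1)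
      (Or.inr (by linarith))).const_mul (β / (ν + 1) * ‖v‖ ^ (ν + 1)))
    refine ((hcomp.sub hlin).sub hpow).congr_deriv ?_
    rw [inner_sub_left, InnerProductSpace.toDual_apply_apply, add_sub_cancel_right]
    field_simp
  have hanti : AntitoneOn φ (Set.Icc 0 1) := by
    refine antitoneOn_of_hasDerivWithinAt_nonpos (convex_Icc 0 1)
      (fun t _ => (hderiv t).continuousAt.continuousWithinAt)
      (fun t _ => (hderiv t).hasDerivWithinAt) fun t ht => ?_
    rw [interior_Icc] at ht
    have hnorm : ‖gradient f (x + t • v) - gradient f x‖ ≤ β * (t ^ ν * ‖v‖ ^ ν) := by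
      have := hH (x + t • v) x
      rwa [add_sub_cancel_left, norm_smul, Real.norm_of_nonneg ht.1.le,
        Real.mul_rpow ht.1.le (norm_nonneg v)] at this
    have hinner := (real_inner_le_norm (gradient f (x + t • v) - gradient f x) v).trans
      (mul_le_mul_of_nonneg_right hnorm (norm_nonneg v))
    rw [Real.rpow_add_one' (norm_nonneg v) hν1]
    linarith
  have h := hanti (Set.left_mem_Icc.2 zero_le_one) (Set.right_mem_Icc.2 zero_le_one) zero_le_one
  simp only [hφ, zero_smul, add_zero, one_smul, zero_mul, one_mul, Real.one_rpow,
    Real.zero_rpow hν1, mul_zero, mul_one, sub_zero] at h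
  linarith

/-- A step of the Hölder gradient method does not increase the value of the function. -/
theorem holder_gradient_step_le {E : Type*} [NormedAddCommGroup E]
    [InnerProductSpace ℝ E] [CompleteSpace E] {f : E → ℝ} (hf : Differentiable ℝ f) {β ν γ : ℝ}
    (hβ : 0 < β) (hν : 0 < ν) (hH : ∀ x y : E, ‖gradient f x - gradient f y‖ ≤ β * ‖x - y‖ ^ ν)
    (hγ : 0 ≤ γ) (hγ' : γ ≤ (ν + 1) / β) (x : E) :
    f (x - (γ * ((ν + 1) / β) ^ (1 / ν - 1) * ‖gradient f x‖ ^ (1 / ν - 1)) • gradient f x)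
      ≤ f x := by
  rcases eq_or_ne (gradient f x) 0 with h0 | h0
  · simp [h0]
  set c := (ν + 1) / β with hc
  set g := ‖gradient f x‖ with hg
  set t := γ * c ^ (1 / ν - 1) * g ^ (1 / ν - 1) with ht
  have hcpos : 0 < c := by positivity
  have hgpos : 0 < g := norm_pos_iff.2 h0
  have htnonneg : 0 ≤ t := by positivity
  have hlen : t * g ≤ (c * g) ^ (1 / ν) := calc
    t * g = γ * (c ^ (1 / ν - 1) * g ^ (1 / ν)) := by
      rw [ht, Real.rpow_sub_one hgpos.ne']; field_simp
    _ ≤ c * (c ^ (1 / ν - 1) * g ^ (1 / ν)) := by gcongr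
    _ = (c * g) ^ (1 / ν) := by
      rw [Real.rpow_sub_one hcpos.ne', Real.mul_rpow hcpos.le hgpos.le]; field_simp
  have hpow : (t * g) ^ ν ≤ c * g := calc
    (t * g) ^ ν ≤ ((c * g) ^ (1 / ν)) ^ ν := by gcongr
    _ = c * g := by rw [← Real.rpow_mul (by positivity), one_div_mul_cancel hν.ne', Real.rpow_one]
  have hrem : β / (ν + 1) * (t * g) ^ (ν + 1) ≤ t * g ^ 2 := calc
    β / (ν + 1) * (t * g) ^ (ν + 1) = c⁻¹ * ((t * g) ^ ν * (t * g)) := by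
      rw [Real.rpow_add_one' (by positivity) (by positivity), hc, inv_div]
    _ ≤ c⁻¹ * (c * g * (t * g)) := by gcongr
    _ = t * g ^ 2 := by field_simp
  have h := le_add_inner_gradient_add_of_gradient_holder hf hν.le hH x (-(t • gradient f x))
  rw [← sub_eq_add_neg, norm_neg, norm_smul, Real.norm_of_nonneg htnonneg, inner_neg_right,
    real_inner_smul_right, real_inner_self_eq_norm_sq, ← hg] at h
  linarith

/-- **Monotonicity of values along the Hölder gradient method.** The values `f(x_n)` are
nonincreasing, and converge if the sequence `(x_n)` is bounded. -/
theorem holder_gradient_values_monotone {d : ℕ}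
    (f : EuclideanSpace ℝ (Fin d) → ℝ) (hf : ContDiff ℝ 1 f)
    (β ν : ℝ) (hβ : 0 < β) (hν : ν ∈ Set.Ioc (0 : ℝ) 1)
    (hH : ∀ x y : EuclideanSpace ℝ (Fin d),
      ‖gradient f x - gradient f y‖ ≤ β * ‖x - y‖ ^ ν)
    (γ : ℝ) (hγ : 0 < γ) (hγ' : γ < (ν + 1) / β)
    (x : ℕ → EuclideanSpace ℝ (Fin d)) (γn : ℕ → ℝ)
    (hγn : ∀ n, γn n = γ * ((ν + 1) / β) ^ (1 / ν - 1) * ‖gradient f (x n)‖ ^ (1 / ν - 1))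
    (hstep : ∀ n, x (n + 1) = x n - γn n • gradient f (x n)) :
    (∀ n, f (x (n + 1)) ≤ f (x n)) ∧
      (Bornology.IsBounded (Set.range x) →
        ∃ l : ℝ, Filter.Tendsto (fun n => f (x n)) Filter.atTop (nhds l)) := by
  have hmono : ∀ n, f (x (n + 1)) ≤ f (x n) := fun n => by
    rw [hstep, hγn]
    exact holder_gradient_step_le (hf.differentiable one_ne_zero) hβ hν.1 hH hγ.le hγ'.le (x n)
  refine ⟨hmono, fun hbdd => ⟨_, tendsto_atTop_ciInf (antitone_nat_of_succ_le hmono) ?_⟩⟩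
  refine (hbdd.isCompact_closure.bddBelow_image hf.continuous.continuousOn).mono ?_
  rintro _ ⟨n, rfl⟩
  exact Set.mem_image_of_mem f (subset_closure (Set.mem_range_self n))
end

section
/- Let f : ℝ^d → ℝ be C¹ with globally (β,ν)-Hölder gradient, β > 0, ν ∈ (0,1], and 0 < γ < (ν+1)/β. Let (x_n) be generated by x_{n+1} = x_n − γ_n ∇f(x_n) with γ_n = γ((ν+1)/β)^{1/ν − 1}‖∇f(x_n)‖^{1/ν − 1}. If f* ∈ ℝ satisfies f(x_n) ≥ f* for all n, then for every n, min_{0 ≤ k ≤ n} ‖∇f(x_k)‖^{1/ν + 1} ≤ [(f(x_0) − f*)/(γ − γ^{ν+1}(β/(ν+1))^ν)] · (β/(ν+1))^{(1−ν)/ν} · 1/(n+1). -/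
/-- The descent inequality for a function whose gradient is `(β, ν)`-Hölder. -/
theorem le_add_inner_gradient_add_of_holder_gradient {E : Type*} [NormedAddCommGroup E]
    [InnerProductSpace ℝ E] [CompleteSpace E] {f : E → ℝ} (hf : Differentiable ℝ f)
    {β ν : ℝ} (hν : 0 < ν)
    (hH : ∀ x y : E, ‖gradient f x - gradient f y‖ ≤ β * ‖x - y‖ ^ ν) (x h : E) :
    f (x + h) ≤ f x + inner ℝ (gradient f x) h + β / (ν + 1) * ‖h‖ ^ (ν + 1) := by
  have hφ (t : ℝ) : HasDerivAt (fun t : ℝ => f (x + t • h))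
      (inner ℝ (gradient f (x + t • h)) h) t := by
    have hline : HasDerivAt (fun t : ℝ => x + t • h) h t := by
      simpa using ((hasDerivAt_id t).smul_const h).const_add x
    have := (hf (x + t • h)).hasGradientAt.hasFDerivAt.comp_hasDerivAt t hline
    exact this.congr_deriv (by simp)
  have hB (t : ℝ) : HasDerivAt
      (fun t : ℝ => f x + t * inner ℝ (gradient f x) h
        + β / (ν + 1) * ‖h‖ ^ (ν + 1) * t ^ (ν + 1))
      (inner ℝ (gradient f x) h + β * ‖h‖ ^ (ν + 1) * t ^ ν) t := by
    have hpow : HasDerivAt (fun t : ℝ => t ^ (ν + 1)) ((ν + 1) * t ^ (ν + 1 - 1)) t :=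
      Real.hasDerivAt_rpow_const (Or.inr (by linarith))
    have := (((hasDerivAt_id t).mul_const (inner ℝ (gradient f x) h)).const_add (f x)).add
      (hpow.const_mul (β / (ν + 1) * ‖h‖ ^ (ν + 1)))
    refine this.congr_deriv ?_
    rw [add_sub_cancel_right]
    field_simp
  have key := image_le_of_deriv_right_le_deriv_boundary (a := 0) (b := 1)
    (fun t _ => (hφ t).continuousAt.continuousWithinAt)
    (fun t _ => (hφ t).hasDerivWithinAt)
    (by simp [Real.zero_rpow (by linarith : ν + 1 ≠ 0)])
    (fun t _ => (hB t).continuousAt.continuousWithinAt)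
    (fun t _ => (hB t).hasDerivWithinAt)
    (fun t ht => by
      have hgrad := hH (x + t • h) x
      rw [add_sub_cancel_left, norm_smul, Real.norm_of_nonneg ht.1,
        Real.mul_rpow ht.1 (norm_nonneg h)] at hgrad
      have hinner := real_inner_le_norm (gradient f (x + t • h) - gradient f x) h
      rw [inner_sub_left] at hinner
      have hmul := mul_le_mul_of_nonneg_right hgrad (norm_nonneg h)
      rw [Real.rpow_add_one' (norm_nonneg h) (by linarith)]
      linarith)
    (Set.right_mem_Icc.2 zero_le_one)
  simpa using key

/-- One step of the Hölder gradient method decreases `f` by a multiple of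
`‖∇f‖ ^ (1 / ν + 1)`. -/
theorem holder_gradient_step_decrease {E : Type*} [NormedAddCommGroup E]
    [InnerProductSpace ℝ E] [CompleteSpace E] {f : E → ℝ} (hf : Differentiable ℝ f)
    {β ν γ : ℝ} (hβ : 0 < β) (hν : 0 < ν) (hγ : 0 < γ)
    (hH : ∀ x y : E, ‖gradient f x - gradient f y‖ ≤ β * ‖x - y‖ ^ ν) (x : E) :
    (γ - γ ^ (ν + 1) * (β / (ν + 1)) ^ ν) * ((ν + 1) / β) ^ (1 / ν - 1)
        * ‖gradient f x‖ ^ (1 / ν + 1)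
      ≤ f x - f (x - (γ * ((ν + 1) / β) ^ (1 / ν - 1) * ‖gradient f x‖ ^ (1 / ν - 1))
          • gradient f x) := by
  rcases eq_or_ne (gradient f x) 0 with h0 | h0
  · simp [h0, Real.zero_rpow (by positivity : ν⁻¹ + 1 ≠ 0)]
  have hg : 0 < ‖gradient f x‖ := norm_pos_iff.2 h0
  have hc : 0 < β / (ν + 1) := by positivity
  have hcinv : (ν + 1) / β = (β / (ν + 1))⁻¹ := (inv_div _ _).symm
  have hexp : (1 / ν - 1) * ν = 1 - ν := by field_simp
  have hs : 0 < ((ν + 1) / β) ^ (1 / ν - 1) := by positivity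
  have hr : 0 < ‖gradient f x‖ ^ (1 / ν - 1) := by positivity
  have hsν : β / (ν + 1) * (((ν + 1) / β) ^ (1 / ν - 1)) ^ ν = (β / (ν + 1)) ^ ν := by
    rw [← Real.rpow_mul (by positivity), hexp, hcinv, Real.inv_rpow hc.le, Real.rpow_sub hc,
      Real.rpow_one]
    field_simp
  have hrν : (‖gradient f x‖ ^ (1 / ν - 1)) ^ ν * ‖gradient f x‖ ^ ν = ‖gradient f x‖ := by
    rw [← Real.rpow_mul hg.le, hexp, ← Real.rpow_add hg, sub_add_cancel, Real.rpow_one]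
  have hrg : ‖gradient f x‖ ^ (1 / ν + 1)
      = ‖gradient f x‖ ^ (1 / ν - 1) * ‖gradient f x‖ ^ 2 := by
    rw [← Real.rpow_natCast, ← Real.rpow_add hg]
    congr 1
    push_cast
    ring
  have hdesc := le_add_inner_gradient_add_of_holder_gradient hf hν hH x
    (-((γ * ((ν + 1) / β) ^ (1 / ν - 1) * ‖gradient f x‖ ^ (1 / ν - 1)) • gradient f x))
  rw [← sub_eq_add_neg, inner_neg_right, inner_smul_right, real_inner_self_eq_norm_sq, norm_neg,
    norm_smul] at hdesc
  rw [hrg]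
  generalize ((ν + 1) / β) ^ (1 / ν - 1) = s at *
  generalize ‖gradient f x‖ ^ (1 / ν - 1) = r at *
  generalize f (x - (γ * s * r) • gradient f x) = y at *
  generalize ‖gradient f x‖ = g at *
  have hquad : β / (ν + 1) * (‖γ * s * r‖ * g) ^ (ν + 1)
      = γ ^ (ν + 1) * (β / (ν + 1)) ^ ν * s * (r * g ^ 2) := by
    rw [Real.norm_of_nonneg (by positivity), Real.rpow_add_one (by positivity),
      Real.rpow_add_one hγ.ne', Real.mul_rpow (by positivity) hg.le,
      Real.mul_rpow (by positivity) hr.le, Real.mul_rpow hγ.le hs.le, ← hsν]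
    linear_combination (β / (ν + 1) * γ ^ ν * s ^ ν * γ * s * r * g) * hrν
  rw [hquad] at hdesc
  linarith

/-- **Complexity of the Hölder gradient method.** -/
theorem holder_gradient_complexity {d : ℕ}
    (f : EuclideanSpace ℝ (Fin d) → ℝ) (hf : ContDiff ℝ 1 f)
    (β ν : ℝ) (hβ : 0 < β) (hν : ν ∈ Set.Ioc (0 : ℝ) 1)
    (hH : ∀ x y : EuclideanSpace ℝ (Fin d),
      ‖gradient f x - gradient f y‖ ≤ β * ‖x - y‖ ^ ν)
    (γ : ℝ) (hγ : 0 < γ) (hγ' : γ < (ν + 1) / β)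
    (x : ℕ → EuclideanSpace ℝ (Fin d)) (γn : ℕ → ℝ)
    (hγn : ∀ n, γn n = γ * ((ν + 1) / β) ^ (1 / ν - 1) * ‖gradient f (x n)‖ ^ (1 / ν - 1))
    (hstep : ∀ n, x (n + 1) = x n - γn n • gradient f (x n))
    (fs : ℝ) (hfs : ∀ n, fs ≤ f (x n)) :
    ∀ n : ℕ, ∃ k ≤ n,
      ‖gradient f (x k)‖ ^ (1 / ν + 1)
        ≤ (f (x 0) - fs) / (γ - γ ^ (ν + 1) * (β / (ν + 1)) ^ ν)
            * (β / (ν + 1)) ^ ((1 - ν) / ν) * (1 / ((n : ℝ) + 1)) := by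
  have hν0 : 0 < ν := hν.1
  have hc : 0 < β / (ν + 1) := by positivity
  have hcinv : (ν + 1) / β = (β / (ν + 1))⁻¹ := (inv_div _ _).symm
  have hD : 0 < γ - γ ^ (ν + 1) * (β / (ν + 1)) ^ ν := by
    have hlt : γ * (β / (ν + 1)) < 1 := by
      rwa [hcinv, lt_inv_comm₀ hγ hc, ← one_div, lt_div_iff₀ hγ, mul_comm] at hγ'
    have hpow : (γ * (β / (ν + 1))) ^ ν < 1 := Real.rpow_lt_one (by positivity) hlt hν0
    rw [Real.mul_rpow hγ.le hc.le] at hpow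
    rw [Real.rpow_add_one hγ.ne']
    nlinarith
  have hK : 0 < (β / (ν + 1)) ^ ((1 - ν) / ν) := by positivity
  have hsK : ((ν + 1) / β) ^ (1 / ν - 1) = ((β / (ν + 1)) ^ ((1 - ν) / ν))⁻¹ := by
    rw [hcinv, Real.inv_rpow hc.le]
    congr 2
    field_simp
  intro n
  by_contra! hlarge
  have hstep_lt : ∀ k ∈ Finset.range (n + 1),
      (f (x 0) - fs) * (1 / ((n : ℝ) + 1)) < f (x k) - f (x (k + 1)) := by
    intro k hk
    have hdec := holder_gradient_step_decrease (hf.differentiable one_ne_zero) hβ hν0 hγ hH (x k)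
    rw [← hγn k, ← hstep k, hsK] at hdec
    refine lt_of_lt_of_le ?_ hdec
    calc (f (x 0) - fs) * (1 / ((n : ℝ) + 1))
        = (γ - γ ^ (ν + 1) * (β / (ν + 1)) ^ ν) * ((β / (ν + 1)) ^ ((1 - ν) / ν))⁻¹ *
          ((f (x 0) - fs) / (γ - γ ^ (ν + 1) * (β / (ν + 1)) ^ ν)
            * (β / (ν + 1)) ^ ((1 - ν) / ν) * (1 / ((n : ℝ) + 1))) := by
          generalize γ - γ ^ (ν + 1) * (β / (ν + 1)) ^ ν = D at *
          generalize (β / (ν + 1)) ^ ((1 - ν) / ν) = K at *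
          field_simp
      _ < _ := mul_lt_mul_of_pos_left (hlarge k (Finset.mem_range_succ_iff.1 hk))
          (by positivity)
  have hsum := Finset.sum_lt_sum_of_nonempty Finset.nonempty_range_add_one hstep_lt
  rw [Finset.sum_range_sub' (fun k => f (x k)), Finset.sum_const, Finset.card_range,
    nsmul_eq_mul] at hsum
  have htotal : ((n + 1 : ℕ) : ℝ) * ((f (x 0) - fs) * (1 / ((n : ℝ) + 1))) = f (x 0) - fs := by
    push_cast
    field_simp
  linarith [hfs (n + 1)]
end

section
/- Let f : ℝ^d → ℝ be C¹ with globally (β,ν)-Hölder gradient, β > 0, ν ∈ (0,1]. Choose γ = ((ν+1)/β)(1/(ν+1))^{1/ν}, and let (x_n) be generated by x_{n+1} = x_n − γ_n ∇f(x_n) with γ_n = γ((ν+1)/β)^{1/ν − 1}‖∇f(x_n)‖^{1/ν − 1}. If f* ∈ ℝ satisfies f(x_n) ≥ f* for all n, then for every n, min_{0 ≤ k ≤ n} ‖∇f(x_k)‖^{1/ν + 1} ≤ (f(x_0) − f*) · β^{1/ν} · (ν+1) / (ν(n+1)). -/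
/-- **Descent lemma** for a differentiable function with Hölder continuous gradient. -/
theorem descent_of_holder_gradient {F : Type*} [NormedAddCommGroup F] [InnerProductSpace ℝ F]
    [CompleteSpace F] {f : F → ℝ} (hf : Differentiable ℝ f) {β ν : ℝ} (hν : 0 < ν)
    (hH : ∀ x y : F, ‖gradient f x - gradient f y‖ ≤ β * ‖x - y‖ ^ ν) (x v : F) :
    f (x + v) ≤ f x + inner ℝ (gradient f x) v + β / (ν + 1) * ‖v‖ ^ (ν + 1) := by
  have hline : ∀ t : ℝ, HasDerivAt (fun t : ℝ => f (x + t • v))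
      (inner ℝ (gradient f (x + t • v)) v) t := by
    intro t
    have h1 : HasDerivAt (fun t : ℝ => x + t • v) v t := by
      simpa using ((hasDerivAt_id t).smul_const v).const_add x
    have h2 := (hf (x + t • v)).hasGradientAt.hasFDerivAt
    exact (h2.comp_hasDerivAt t h1).congr_deriv (by simp)
  have hbound : ∀ t : ℝ, HasDerivAt
      (fun t : ℝ => f x + t * inner ℝ (gradient f x) v
        + β / (ν + 1) * ‖v‖ ^ (ν + 1) * t ^ (ν + 1))
      (inner ℝ (gradient f x) v + β * ‖v‖ ^ (ν + 1) * t ^ ν) t := by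
    intro t
    have h1 := Real.hasDerivAt_rpow_const (x := t) (p := ν + 1) (Or.inr (by linarith))
    have h2 := (((hasDerivAt_id t).mul_const (inner ℝ (gradient f x) v)).const_add (f x)).add
      (h1.const_mul (β / (ν + 1) * ‖v‖ ^ (ν + 1)))
    refine h2.congr_deriv ?_
    rw [add_sub_cancel_right]
    field_simp
  have key := image_le_of_deriv_right_le_deriv_boundary (a := (0 : ℝ)) (b := 1)
    (fun t _ => (hline t).continuousAt.continuousWithinAt)
    (fun t _ => (hline t).hasDerivWithinAt)
    (by simp [Real.zero_rpow (by linarith : ν + 1 ≠ 0)])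
    (fun t _ => (hbound t).continuousAt.continuousWithinAt)
    (fun t _ => (hbound t).hasDerivWithinAt)
    (fun t ht => by
      have h1 : inner ℝ (gradient f (x + t • v) - gradient f x) v
          ≤ ‖gradient f (x + t • v) - gradient f x‖ * ‖v‖ := real_inner_le_norm _ _
      have h2 := mul_le_mul_of_nonneg_right (hH (x + t • v) x) (norm_nonneg v)
      rw [add_sub_cancel_left, norm_smul, Real.norm_of_nonneg ht.1,
        Real.mul_rpow ht.1 (norm_nonneg v)] at h2
      rw [inner_sub_left] at h1
      rw [Real.rpow_add_one' (norm_nonneg v) (by linarith)]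
      linarith)
    (Set.right_mem_Icc.2 zero_le_one)
  simpa using key

/-- Per-step decrease of the Hölder gradient method with step size
`β ^ (-1 / ν) * ‖∇f x‖ ^ (1 / ν - 1)`. -/
theorem decrease_of_holder_gradient {F : Type*} [NormedAddCommGroup F] [InnerProductSpace ℝ F]
    [CompleteSpace F] {f : F → ℝ} (hf : Differentiable ℝ f) {β ν : ℝ} (hβ : 0 < β) (hν : 0 < ν)
    (hH : ∀ x y : F, ‖gradient f x - gradient f y‖ ≤ β * ‖x - y‖ ^ ν) (x : F) :
    f (x - ((β ^ (1 / ν))⁻¹ * ‖gradient f x‖ ^ (1 / ν - 1)) • gradient f x)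
      ≤ f x - ν / (ν + 1) * (β ^ (1 / ν))⁻¹ * ‖gradient f x‖ ^ (1 / ν + 1) := by
  have hd := descent_of_holder_gradient hf hν hH x
    (-(((β ^ (1 / ν))⁻¹ * ‖gradient f x‖ ^ (1 / ν - 1)) • gradient f x))
  have hν' : 0 < 1 / ν := by positivity
  have hb : 0 < β ^ (1 / ν) := Real.rpow_pos_of_pos hβ _
  have hg := norm_nonneg (gradient f x)
  rw [← sub_eq_add_neg, norm_neg, inner_neg_right, real_inner_smul_right,
    real_inner_self_eq_norm_sq, norm_smul, Real.norm_of_nonneg (by positivity)] at hd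
  generalize ‖gradient f x‖ = g at hd hg ⊢
  have h1 : g ^ (1 / ν - 1) * g = g ^ (1 / ν) := by
    rw [← Real.rpow_add_one' hg (by simpa using hν.ne'), sub_add_cancel]
  have h2 : g ^ (1 / ν) * g = g ^ (1 / ν + 1) := (Real.rpow_add_one' hg (by linarith)).symm
  have h3 : ∀ a : ℝ, 0 ≤ a → (a ^ (1 / ν)) ^ (ν + 1) = a ^ (1 / ν) * a := by
    intro a ha
    rw [← Real.rpow_mul ha, ← Real.rpow_add_one' ha (by linarith)]
    congr 1
    field_simp
    ring
  rw [mul_assoc _ _ g, h1, Real.mul_rpow (by positivity) (by positivity),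
    Real.inv_rpow hb.le, h3 g hg, h3 β hβ.le, sq, mul_assoc _ _ (g * g), ← mul_assoc _ g g,
    h1, h2] at hd
  refine hd.trans_eq ?_
  field_simp
  ring

/-- **Complexity of the Hölder gradient method with the optimal step parameter**
`γ = ((ν+1)/β) (1/(ν+1))^(1/ν)`. -/
theorem holder_gradient_complexity_optimal_step {d : ℕ}
    (f : EuclideanSpace ℝ (Fin d) → ℝ) (hf : ContDiff ℝ 1 f)
    (β ν : ℝ) (hβ : 0 < β) (hν : ν ∈ Set.Ioc (0 : ℝ) 1)
    (hH : ∀ x y : EuclideanSpace ℝ (Fin d),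
      ‖gradient f x - gradient f y‖ ≤ β * ‖x - y‖ ^ ν)
    (γ : ℝ) (hγdef : γ = ((ν + 1) / β) * (1 / (ν + 1)) ^ (1 / ν))
    (x : ℕ → EuclideanSpace ℝ (Fin d)) (γn : ℕ → ℝ)
    (hγn : ∀ n, γn n = γ * ((ν + 1) / β) ^ (1 / ν - 1) * ‖gradient f (x n)‖ ^ (1 / ν - 1))
    (hstep : ∀ n, x (n + 1) = x n - γn n • gradient f (x n))
    (fs : ℝ) (hfs : ∀ n, fs ≤ f (x n)) :
    ∀ n : ℕ, ∃ k ≤ n,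
      ‖gradient f (x k)‖ ^ (1 / ν + 1)
        ≤ (f (x 0) - fs) * β ^ (1 / ν) * (ν + 1) / (ν * ((n : ℝ) + 1)) := by
  obtain ⟨hν0, -⟩ := hν
  have hb : 0 < β ^ (1 / ν) := Real.rpow_pos_of_pos hβ _
  have hc : γ * ((ν + 1) / β) ^ (1 / ν - 1) = (β ^ (1 / ν))⁻¹ := by
    have hq : 0 < (ν + 1) / β := by positivity
    rw [hγdef, mul_right_comm, mul_comm ((ν + 1) / β), ← Real.rpow_add_one hq.ne',
      sub_add_cancel, ← Real.mul_rpow hq.le (by positivity), ← Real.inv_rpow hβ.le]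
    congr 1
    field_simp
  have hdec : ∀ k, ν / (ν + 1) * (β ^ (1 / ν))⁻¹ * ‖gradient f (x k)‖ ^ (1 / ν + 1)
      ≤ f (x k) - f (x (k + 1)) := by
    intro k
    have h := decrease_of_holder_gradient (hf.differentiable one_ne_zero) hβ hν0 hH (x k)
    rw [← hc, ← hγn, ← hstep, hc] at h
    linarith
  intro n
  by_contra! hlt
  have hsum : ∑ _k ∈ Finset.range (n + 1), (f (x 0) - fs) / (n + 1)
      < ∑ k ∈ Finset.range (n + 1), (f (x k) - f (x (k + 1))) := by
    refine Finset.sum_lt_sum_of_nonempty Finset.nonempty_range_add_one fun k hk => ?_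
    refine lt_of_lt_of_le ?_ (hdec k)
    have h := mul_lt_mul_of_pos_left (hlt k (Finset.mem_range_succ_iff.1 hk))
      (by positivity : 0 < ν / (ν + 1) * (β ^ (1 / ν))⁻¹)
    refine lt_of_eq_of_lt ?_ h
    field_simp
  rw [Finset.sum_range_sub', Finset.sum_const, Finset.card_range, nsmul_eq_mul,
    Nat.cast_add_one, mul_div_cancel₀ _ (by positivity)] at hsum
  linarith [hfs (n + 1)]
end

section
/- Let 𝒴 ⊆ ℝ^{d'} be nonempty and compact, and let L : ℝ^d × ℝ^{d'} → ℝ be continuous with partial gradient ∇ₓL(x,y) in the x-variable existing everywhere and jointly continuous in (x,y). Suppose that for every x ∈ ℝ^d the set argmax_{y ∈ 𝒴} L(x, y) is a singleton {p(x)} and that p : ℝ^d → ℝ^{d'} is continuous. Then the value function g(x) := max_{y ∈ 𝒴} L(x, y) is differentiable on ℝ^d and, for every x̄ ∈ ℝ^d, ∇g(x̄) = ∇ₓL(x̄, p(x̄)). -/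
open Filter Topology in
/-- If the partial gradient of `L` in its first variable exists and is continuous, then the
first-order expansion in that variable is uniform in the second variable. -/
theorem eventually_abs_sub_sub_inner_le {E F : Type*} [NormedAddCommGroup E]
    [InnerProductSpace ℝ E] [CompleteSpace E] [TopologicalSpace F] {L : E → F → ℝ} {G : E → F → E}
    (hG : ∀ x y, HasGradientAt (fun x' => L x' y) (G x y) x) {a : E} {b : F}
    (hGcont : ContinuousAt (fun q : E × F => G q.1 q.2) (a, b)) {ε : ℝ} (hε : 0 < ε) :
    ∀ᶠ q : E × F in 𝓝 a ×ˢ 𝓝 b,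
      |L q.1 q.2 - L a q.2 - inner ℝ (G a b) (q.1 - a)| ≤ ε * ‖q.1 - a‖ := by
  have hnear : ∀ᶠ q : E × F in 𝓝 a ×ˢ 𝓝 b, ‖G q.1 q.2 - G a b‖ < ε := by
    rw [← nhds_prod_eq]
    filter_upwards [hGcont.eventually (Metric.ball_mem_nhds _ hε)] with q hq
    rwa [← dist_eq_norm]
  obtain ⟨P, hP, Q, hQ, hPQ⟩ := eventually_prod_iff.1 hnear
  obtain ⟨r, hr, hball⟩ := Metric.eventually_nhds_iff_ball.1 hP
  filter_upwards [prod_mem_prod (Metric.ball_mem_nhds a hr) hQ]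
  rintro ⟨x, y⟩ ⟨hx, hy⟩
  have key := (convex_ball a r).norm_image_sub_le_of_norm_hasFDerivWithin_le'
    (f := fun x' => L x' y) (φ := InnerProductSpace.toDual ℝ E (G a b)) (C := ε)
    (fun z _ => (hG z y).hasFDerivAt.hasFDerivWithinAt)
    (fun z hz => by
      rw [← map_sub, LinearIsometryEquiv.norm_map]
      exact (hPQ (hball z hz) hy).le)
    (Metric.mem_ball_self hr) hx
  simpa using key

/-- **Differentiability of the value function (Danskin-type formula).** If the argmax of
`L(x, ·)` over the nonempty compact set `𝒴` is a singleton `{p x}` with `p` continuous, and the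
partial gradient `∇ₓL` exists everywhere and is jointly continuous, then the value function
`g(x) = max_{y ∈ 𝒴} L(x,y)` is differentiable with `∇g(x̄) = ∇ₓL(x̄, p(x̄))`. -/
theorem value_function_gradient {d d' : ℕ}
    (Y : Set (EuclideanSpace ℝ (Fin d'))) (hYne : Y.Nonempty) (hYcomp : IsCompact Y)
    (L : EuclideanSpace ℝ (Fin d) → EuclideanSpace ℝ (Fin d') → ℝ)
    (hL : Continuous fun q : EuclideanSpace ℝ (Fin d) × EuclideanSpace ℝ (Fin d') =>
      L q.1 q.2)
    (Gx : EuclideanSpace ℝ (Fin d) → EuclideanSpace ℝ (Fin d') → EuclideanSpace ℝ (Fin d))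
    (hGx : ∀ x y, HasGradientAt (fun x' => L x' y) (Gx x y) x)
    (hGxcont : Continuous fun q : EuclideanSpace ℝ (Fin d) × EuclideanSpace ℝ (Fin d') =>
      Gx q.1 q.2)
    (p : EuclideanSpace ℝ (Fin d) → EuclideanSpace ℝ (Fin d'))
    (hp : ∀ x, {y | y ∈ Y ∧ ∀ z ∈ Y, L x z ≤ L x y} = {p x})
    (hpcont : Continuous p)
    (g : EuclideanSpace ℝ (Fin d) → ℝ) (hg : ∀ x, g x = L x (p x)) :
    ∀ xbar : EuclideanSpace ℝ (Fin d), HasGradientAt g (Gx xbar (p xbar)) xbar := by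
  intro a
  have hmax : ∀ x, p x ∈ Y ∧ ∀ z ∈ Y, L x z ≤ L x (p x) := fun x => by
    have h : p x ∈ {y | y ∈ Y ∧ ∀ z ∈ Y, L x z ≤ L x y} := by simp [hp x]
    exact h
  rw [hasGradientAt_iff_isLittleO, Asymptotics.isLittleO_iff]
  intro ε hε
  have hexp := eventually_abs_sub_sub_inner_le hGx (hGxcont.continuousAt (x := (a, p a))) hε
  have hmoving := (Filter.tendsto_id.prodMk (hpcont.tendsto a)).eventually hexp
  have hfixed := (Filter.tendsto_id.prodMk (tendsto_const_nhds (x := p a))).eventually hexp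
  filter_upwards [hmoving, hfixed] with x h₁ h₂
  simp only [id_eq, abs_le] at h₁ h₂
  rw [Real.norm_eq_abs, abs_le, hg, hg]
  have hx := (hmax x).2 _ (hmax a).1
  have ha := (hmax a).2 _ (hmax x).1
  constructor <;> linarith [h₁.2, h₂.1]
end

section
/- Let f : ℝ^d → ℝ be C¹, let δ, α ∈ (0,1) and γ, ρ > 0, and let x ∈ ℝ^d. Then there exists k ∈ ℕ such that, with λ_k := α^k · min{1, ‖∇f(x)‖^{ρk}} · γ, one has f(x − λ_k ∇f(x)) ≤ f(x) − δ λ_k ‖∇f(x)‖². (In other words, the backtracking while-loop of the Backtrack Hölder gradient method terminates at every point.) -/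
/-- A `δ`-sufficient-decrease condition holds for all small enough gradient steps. -/
theorem eventually_sufficient_decrease {E : Type*} [NormedAddCommGroup E] [InnerProductSpace ℝ E]
    [CompleteSpace E] {f : E → ℝ} {g x : E} (hf : HasGradientAt f g x) {δ : ℝ} (hδ : δ < 1) :
    ∀ᶠ t in nhdsWithin (0 : ℝ) (Set.Ici 0), f (x - t • g) ≤ f x - δ * t * ‖g‖ ^ 2 := by
  rcases eq_or_ne g 0 with rfl | hg
  · simp
  have hc : 0 < (1 - δ) * ‖g‖ := mul_pos (sub_pos.2 hδ) (norm_pos_iff.2 hg)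
  have hstep : Filter.Tendsto (fun t : ℝ => x - t • g) (nhdsWithin 0 (Set.Ici 0)) (nhds x) := by
    have hcont : Continuous fun t : ℝ => x - t • g := by fun_prop
    simpa using (hcont.tendsto 0).mono_left nhdsWithin_le_nhds
  filter_upwards [hstep.eventually ((hasGradientAt_iff_isLittleO.1 hf).bound hc),
    self_mem_nhdsWithin] with t hbound ht
  have ht : 0 ≤ t := ht
  have hinner : inner ℝ g (x - t • g - x) = -(t * ‖g‖ ^ 2) := by
    rw [sub_sub_cancel_left, inner_neg_right, real_inner_smul_right, real_inner_self_eq_norm_sq]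
  have hnorm : ‖x - t • g - x‖ = t * ‖g‖ := by
    rw [sub_sub_cancel_left, norm_neg, norm_smul, Real.norm_of_nonneg ht]
  rw [hinner, hnorm, Real.norm_eq_abs] at hbound
  linarith [(abs_le.1 hbound).2]

/-- **Termination of the backtracking loop of the Backtrack Hölder gradient method.** For any
`C¹` function `f`, any `δ, α ∈ (0,1)`, `γ, ρ > 0` and any point `x`, there is some `k ∈ ℕ` for
which the candidate step size `λ_k = α^k min{1, ‖∇f(x)‖^(ρk)} γ` satisfies the
sufficient-decrease condition. -/
theorem backtracking_terminates {d : ℕ}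
    (f : EuclideanSpace ℝ (Fin d) → ℝ) (hf : ContDiff ℝ 1 f)
    (δ α : ℝ) (hδ : δ ∈ Set.Ioo (0 : ℝ) 1) (hα : α ∈ Set.Ioo (0 : ℝ) 1)
    (γ ρ : ℝ) (hγ : 0 < γ) (hρ : 0 < ρ)
    (x : EuclideanSpace ℝ (Fin d)) :
    ∃ k : ℕ,
      f (x - (α ^ k * min 1 (‖gradient f x‖ ^ (ρ * k)) * γ) • gradient f x)
        ≤ f x - δ * (α ^ k * min 1 (‖gradient f x‖ ^ (ρ * k)) * γ) * ‖gradient f x‖ ^ 2 := by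
  have hnonneg : ∀ k : ℕ, 0 ≤ α ^ k * min 1 (‖gradient f x‖ ^ (ρ * k)) * γ := fun k =>
    mul_nonneg (mul_nonneg (pow_nonneg hα.1.le k)
      (le_min zero_le_one (Real.rpow_nonneg (norm_nonneg _) _))) hγ.le
  have hle : ∀ k : ℕ, α ^ k * min 1 (‖gradient f x‖ ^ (ρ * k)) * γ ≤ α ^ k * γ := fun k =>
    mul_le_mul_of_nonneg_right
      (mul_le_of_le_one_right (pow_nonneg hα.1.le k) (min_le_left _ _)) hγ.le
  have hpow : Filter.Tendsto (fun k : ℕ => α ^ k * γ) Filter.atTop (nhds 0) := by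
    simpa using (tendsto_pow_atTop_nhds_zero_of_lt_one hα.1.le hα.2).mul_const γ
  have hstep := tendsto_nhdsWithin_iff.2
    ⟨squeeze_zero hnonneg hle hpow, Filter.Eventually.of_forall hnonneg⟩
  have hgrad : HasGradientAt f (gradient f x) x :=
    (hf.differentiable one_ne_zero x).hasGradientAt
  exact (hstep.eventually (eventually_sufficient_decrease hgrad hδ.2)).exists
end

section
/- Let f : ℝ^d → ℝ be C¹ with globally (β,ν)-Hölder gradient, β > 0, ν ∈ (0,1], and let δ, α ∈ (0,1) and γ, ρ > 0. Then for every integer k ≥ max{ log((1−δ)(ν+1)/(γ^ν β)) / (ν log α), (1−ν)/(ρν) } and every x ∈ ℝ^d, the step size λ := α^k · min{1, ‖∇f(x)‖^{ρk}} · γ satisfies the sufficient-decrease condition f(x − λ∇f(x)) ≤ f(x) − δ λ ‖∇f(x)‖². Consequently, along the monotone Backtrack Hölder gradient method the inner counters satisfy sup_n k_n ≤ 1 + (1/ν) max{ log((1−δ)(ν+1)/(γ^ν β)) / log α, (1−ν)/ρ }. -/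
/-- Candidate step size `α^k · min{1, ‖∇f(x)‖^(ρk)} · γ` of the Backtrack Hölder gradient
method. -/
noncomputable def holderStep {d : ℕ} (f : EuclideanSpace ℝ (Fin d) → ℝ) (α ρ γ : ℝ)
    (x : EuclideanSpace ℝ (Fin d)) (k : ℕ) : ℝ :=
  α ^ k * min 1 (‖gradient f x‖ ^ (ρ * k)) * γ

/-- The sufficient-decrease condition tested by the backtracking while-loop. -/
noncomputable def suffDecrease {d : ℕ} (f : EuclideanSpace ℝ (Fin d) → ℝ) (δ α ρ γ : ℝ)
    (x : EuclideanSpace ℝ (Fin d)) (k : ℕ) : Prop :=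
  f (x - holderStep f α ρ γ x k • gradient f x)
    ≤ f x - δ * holderStep f α ρ γ x k * ‖gradient f x‖ ^ 2

/-- **Descent lemma** for a differentiable function with globally `(β,ν)`-Hölder gradient. -/
theorem le_add_inner_add_of_holder_gradient {E : Type*} [NormedAddCommGroup E]
    [InnerProductSpace ℝ E] [CompleteSpace E] {f : E → ℝ} (hf : Differentiable ℝ f)
    {β ν : ℝ} (hν : 0 < ν)
    (hH : ∀ x y, ‖gradient f x - gradient f y‖ ≤ β * ‖x - y‖ ^ ν) (x v : E) :
    f (x + v) ≤ f x + inner ℝ (gradient f x) v + β / (ν + 1) * ‖v‖ ^ (ν + 1) := by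
  let ψ : ℝ → ℝ := fun t ↦
    f (x + t • v) - t * inner ℝ (gradient f x) v - β / (ν + 1) * ‖v‖ ^ (ν + 1) * t ^ (ν + 1)
  have hψ (t : ℝ) : HasDerivAt ψ (inner ℝ (gradient f (x + t • v)) v
      - inner ℝ (gradient f x) v - β * ‖v‖ ^ (ν + 1) * t ^ ν) t := by
    have hline : HasDerivAt (fun t : ℝ ↦ x + t • v) v t := by
      simpa using ((hasDerivAt_id t).smul_const v).const_add x
    have hcomp : HasDerivAt (fun t : ℝ ↦ f (x + t • v))
        (inner ℝ (gradient f (x + t • v)) v) t := by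
      exact ((hf (x + t • v)).hasGradientAt.hasFDerivAt.comp_hasDerivAt t hline).congr_deriv
        (InnerProductSpace.toDual_apply_apply ..)
    have hpow := (Real.hasDerivAt_rpow_const (x := t) (p := ν + 1)
      (Or.inr (by linarith))).const_mul (β / (ν + 1) * ‖v‖ ^ (ν + 1))
    have hlin := (hasDerivAt_id t).mul_const (inner ℝ (gradient f x) v)
    refine ((hcomp.sub hlin).sub hpow).congr_deriv ?_
    rw [add_sub_cancel_right]
    field_simp
  have hanti : AntitoneOn ψ (Set.Icc 0 1) := by
    refine antitoneOn_of_deriv_nonpos (convex_Icc 0 1)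
      (fun t _ ↦ (hψ t).continuousAt.continuousWithinAt)
      (fun t _ ↦ (hψ t).differentiableAt.differentiableWithinAt) fun t ht ↦ ?_
    rw [interior_Icc] at ht
    rw [(hψ t).deriv, ← inner_sub_left, sub_nonpos]
    calc inner ℝ (gradient f (x + t • v) - gradient f x) v
        ≤ ‖gradient f (x + t • v) - gradient f x‖ * ‖v‖ := real_inner_le_norm _ _
      _ ≤ β * ‖x + t • v - x‖ ^ ν * ‖v‖ := by gcongr; exact hH _ _
      _ = β * ‖v‖ ^ (ν + 1) * t ^ ν := by
        rw [add_sub_cancel_left, norm_smul, Real.norm_of_nonneg ht.1.le,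
          Real.mul_rpow ht.1.le (norm_nonneg v),
          Real.rpow_add_one' (norm_nonneg v) (by linarith)]
        ring
  have h := hanti (Set.left_mem_Icc.2 zero_le_one) (Set.right_mem_Icc.2 zero_le_one) zero_le_one
  simp only [ψ, one_smul, one_mul, Real.one_rpow, mul_one, zero_smul, add_zero, zero_mul,
    sub_zero, Real.zero_rpow (by linarith : ν + 1 ≠ 0), mul_zero] at h
  linarith

/-- For `t > 0` the damping factor `min{1, t^s}` satisfies `min{1, t^s}^ν ≤ t^(1-ν)` as soon as
`s ν ≥ 1 - ν`. -/
theorem min_one_rpow_rpow_le {t s ν : ℝ} (ht : 0 < t) (hν : 0 ≤ ν) (hν1 : ν ≤ 1)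
    (hs : 1 - ν ≤ s * ν) : min 1 (t ^ s) ^ ν ≤ t ^ (1 - ν) := by
  have hmin : 0 ≤ min 1 (t ^ s) := by positivity
  rcases le_total 1 t with h | h
  · exact (Real.rpow_le_one hmin (min_le_left _ _) hν).trans
      (Real.one_le_rpow h (by linarith))
  · calc min 1 (t ^ s) ^ ν ≤ (t ^ s) ^ ν := by gcongr; exact min_le_right _ _
      _ = t ^ (s * ν) := (Real.rpow_mul ht.le _ _).symm
      _ ≤ t ^ (1 - ν) := Real.rpow_le_rpow_of_exponent_ge ht h hs

/-- Past the logarithmic threshold, `α^k γ` is small enough for the Hölder constant. -/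
theorem mul_rpow_pow_mul_le_of_log_div_le {α γ β ν c : ℝ} {k : ℕ} (hα : α ∈ Set.Ioo (0 : ℝ) 1)
    (hγ : 0 < γ) (hβ : 0 < β) (hν : 0 < ν) (hc : 0 < c)
    (hk : Real.log (c / (γ ^ ν * β)) / (ν * Real.log α) ≤ k) :
    β * (α ^ k * γ) ^ ν ≤ c := by
  have hα0 := hα.1
  have hlog : ν * Real.log α < 0 := mul_neg_of_pos_of_neg hν (Real.log_neg hα.1 hα.2)
  have h : (α ^ k) ^ ν ≤ c / (γ ^ ν * β) := by
    rw [← Real.log_le_log_iff (by positivity) (by positivity),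
      Real.log_rpow (by positivity), Real.log_pow]
    linarith [(div_le_iff_of_neg hlog).1 hk]
  rw [le_div_iff₀ (by positivity)] at h
  rw [Real.mul_rpow (by positivity) hγ.le]
  linarith

/-- **Uniform bound on the backtracking counters.** If `∇f` is globally `(β,ν)`-Hölder then
every `k` past an explicit threshold satisfies the sufficient-decrease condition at every
point; consequently, along the monotone Backtrack Hölder gradient method the counters satisfy
`k_n ≤ 1 + (1/ν) max{log((1-δ)(ν+1)/(γ^ν β))/log α, (1-ν)/ρ}`. -/
theorem backtrack_holder_counter_bound {d : ℕ}
    (f : EuclideanSpace ℝ (Fin d) → ℝ) (hf : ContDiff ℝ 1 f)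
    (β ν : ℝ) (hβ : 0 < β) (hν : ν ∈ Set.Ioc (0 : ℝ) 1)
    (hH : ∀ x y : EuclideanSpace ℝ (Fin d),
      ‖gradient f x - gradient f y‖ ≤ β * ‖x - y‖ ^ ν)
    (δ α : ℝ) (hδ : δ ∈ Set.Ioo (0 : ℝ) 1) (hα : α ∈ Set.Ioo (0 : ℝ) 1)
    (γ ρ : ℝ) (hγ : 0 < γ) (hρ : 0 < ρ) :
    (∀ k : ℕ,
        max (Real.log ((1 - δ) * (ν + 1) / (γ ^ ν * β)) / (ν * Real.log α))
            ((1 - ν) / (ρ * ν)) ≤ (k : ℝ) →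
      ∀ x : EuclideanSpace ℝ (Fin d), suffDecrease f δ α ρ γ x k) ∧
    (∀ (x : ℕ → EuclideanSpace ℝ (Fin d)) (k : ℕ → ℕ),
      (∀ n, suffDecrease f δ α ρ γ (x n) (k n)) →
      (∀ j, j < k 0 → ¬ suffDecrease f δ α ρ γ (x 0) j) →
      (∀ n, k n ≤ k (n + 1)) →
      (∀ n j, k n ≤ j → j < k (n + 1) → ¬ suffDecrease f δ α ρ γ (x (n + 1)) j) →
      (∀ n, x (n + 1) = x n - holderStep f α ρ γ (x n) (k n) • gradient f (x n)) →
      ∀ n, (k n : ℝ) ≤ 1 + (1 / ν) *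
        max (Real.log ((1 - δ) * (ν + 1) / (γ ^ ν * β)) / Real.log α) ((1 - ν) / ρ)) := by
  obtain ⟨hν0, hν1⟩ := hν
  have key : ∀ k : ℕ,
      max (Real.log ((1 - δ) * (ν + 1) / (γ ^ ν * β)) / (ν * Real.log α))
          ((1 - ν) / (ρ * ν)) ≤ (k : ℝ) →
        ∀ x : EuclideanSpace ℝ (Fin d), suffDecrease f δ α ρ γ x k := by
    intro k hk x
    obtain ⟨hk₁, hk₂⟩ := max_le_iff.1 hk
    rcases eq_or_ne (gradient f x) 0 with hg | hg
    · simp [suffDecrease, hg]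
    have ht : 0 < ‖gradient f x‖ := norm_pos_iff.2 hg
    have hα0 := hα.1
    have hstep : 0 < holderStep f α ρ γ x k := by unfold holderStep; positivity
    have hsmall : β * holderStep f α ρ γ x k ^ ν ≤
        (1 - δ) * (ν + 1) * ‖gradient f x‖ ^ (1 - ν) := by
      have h₁ := mul_rpow_pow_mul_le_of_log_div_le hα hγ hβ hν0
        (mul_pos (sub_pos.2 hδ.2) (by linarith)) hk₁
      have h₂ : min 1 (‖gradient f x‖ ^ (ρ * k)) ^ ν ≤ ‖gradient f x‖ ^ (1 - ν) := by
        refine min_one_rpow_rpow_le ht hν0.le hν1 ?_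
        rw [div_le_iff₀ (by positivity)] at hk₂
        linarith
      calc β * holderStep f α ρ γ x k ^ ν
          = β * (α ^ k * γ) ^ ν * min 1 (‖gradient f x‖ ^ (ρ * k)) ^ ν := by
            rw [holderStep, mul_right_comm, Real.mul_rpow (by positivity) (by positivity),
              mul_assoc]
        _ ≤ _ := mul_le_mul h₁ h₂ (by positivity) (by nlinarith [hδ.2])
    have hdesc := le_add_inner_add_of_holder_gradient (hf.differentiable one_ne_zero) hν0 hH x
      (-(holderStep f α ρ γ x k • gradient f x))
    rw [← sub_eq_add_neg, inner_neg_right, real_inner_smul_right, real_inner_self_eq_norm_sq,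
      norm_neg, norm_smul, Real.norm_of_nonneg hstep.le,
      Real.mul_rpow hstep.le ht.le, Real.rpow_add_one hstep.ne'] at hdesc
    have hsq : ‖gradient f x‖ ^ (1 - ν) * ‖gradient f x‖ ^ (ν + 1) = ‖gradient f x‖ ^ 2 := by
      rw [← Real.rpow_add ht, ← Real.rpow_two]
      ring_nf
    have hrem : β / (ν + 1) * (holderStep f α ρ γ x k ^ ν * holderStep f α ρ γ x k *
        ‖gradient f x‖ ^ (ν + 1)) ≤ (1 - δ) * holderStep f α ρ γ x k * ‖gradient f x‖ ^ 2 := by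
      rw [div_mul_eq_mul_div, div_le_iff₀ (by linarith)]
      calc _ = β * holderStep f α ρ γ x k ^ ν *
            (holderStep f α ρ γ x k * ‖gradient f x‖ ^ (ν + 1)) := by ring
        _ ≤ (1 - δ) * (ν + 1) * ‖gradient f x‖ ^ (1 - ν) *
            (holderStep f α ρ γ x k * ‖gradient f x‖ ^ (ν + 1)) := by gcongr
        _ = _ := by rw [← hsq]; ring
    unfold suffDecrease
    linarith
  refine ⟨key, fun x k _ hfirst hmono hfail _ n ↦ ?_⟩
  have hthreshold : (1 / ν) *
      max (Real.log ((1 - δ) * (ν + 1) / (γ ^ ν * β)) / Real.log α) ((1 - ν) / ρ) =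
      max (Real.log ((1 - δ) * (ν + 1) / (γ ^ ν * β)) / (ν * Real.log α))
        ((1 - ν) / (ρ * ν)) := by
    rw [mul_max_of_nonneg _ _ (by positivity), div_mul_div_comm, div_mul_div_comm, one_mul,
      one_mul, mul_comm ν ρ]
  rw [hthreshold]
  have hnonneg : 0 ≤ max (Real.log ((1 - δ) * (ν + 1) / (γ ^ ν * β)) / (ν * Real.log α))
      ((1 - ν) / (ρ * ν)) :=
    le_max_of_le_right (div_nonneg (by linarith) (by positivity))
  have hreject (j : ℕ) (y : EuclideanSpace ℝ (Fin d)) (hj : ¬ suffDecrease f δ α ρ γ y j) :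
      (j : ℝ) < max (Real.log ((1 - δ) * (ν + 1) / (γ ^ ν * β)) / (ν * Real.log α))
        ((1 - ν) / (ρ * ν)) :=
    lt_of_not_ge fun h ↦ hj (key j h y)
  induction n with
  | zero =>
    rcases hk : k 0 with _ | j
    · push_cast; linarith
    · have := hreject j _ (hfirst j (by omega))
      push_cast; linarith
  | succ n ih =>
    rcases (hmono n).eq_or_lt with h | h
    · rwa [← h]
    · obtain ⟨j, hj⟩ : ∃ j, k (n + 1) = j + 1 := Nat.exists_eq_succ_of_ne_zero (by omega)
      have := hreject j _ (hfail n j (by omega) (by omega))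
      rw [hj]
      push_cast; linarith
end

section
/- Let f : ℝ^d → ℝ be C¹ and let δ, α ∈ (0,1), γ, ρ > 0, k̄ ∈ ℕ, and f* ∈ ℝ. Let (x_n) in ℝ^d and (k_n) in ℕ with k_n ≤ k̄ for all n satisfy, for all n: x_{n+1} = x_n − γ_n ∇f(x_n) where γ_n = α^{k_n} min{1, ‖∇f(x_n)‖^{ρ k_n}} γ, together with f(x_{n+1}) ≤ f(x_n) − δ γ_n ‖∇f(x_n)‖² and f(x_n) ≥ f*. If moreover ‖∇f(x_n)‖ ≤ 1 for all n, then for every n, min_{0 ≤ i ≤ n} ‖∇f(x_i)‖^{2 + ρ k̄} ≤ (f(x_0) − f*) / (δ α^{k̄} γ (n+1)); in particular min_{0 ≤ i ≤ n} ‖∇f(x_i)‖ = O(n^{−1/(2 + ρ k̄)}). -/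
/-- If a sequence bounded below by `fs` decreases by at least `C * a n` at step `n`, then one of
the first `n + 1` values of `a` is at most `(F 0 - fs) / (C * (n + 1))`. -/
lemma exists_le_div_of_sufficient_decrease {F a : ℕ → ℝ} {C fs : ℝ} (hC : 0 < C)
    (hdesc : ∀ n, F (n + 1) ≤ F n - C * a n) (hlb : ∀ n, fs ≤ F n) (n : ℕ) :
    ∃ i ≤ n, a i ≤ (F 0 - fs) / (C * ((n : ℝ) + 1)) := by
  have hsum : ∀ m : ℕ, F m + C * ∑ i ∈ Finset.range m, a i ≤ F 0 := by
    intro m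
    induction m with
    | zero => simp
    | succ m ih =>
      rw [Finset.sum_range_succ, mul_add]
      linarith [hdesc m]
  by_contra! h
  have hlt : ∑ _i ∈ Finset.range (n + 1), (F 0 - fs) / (C * ((n : ℝ) + 1))
      < ∑ i ∈ Finset.range (n + 1), a i :=
    Finset.sum_lt_sum_of_nonempty (by simp)
      fun i hi => h i (Nat.lt_succ_iff.mp (Finset.mem_range.mp hi))
  have hconst : C * ∑ _i ∈ Finset.range (n + 1), (F 0 - fs) / (C * ((n : ℝ) + 1)) = F 0 - fs := by
    have hn : (n : ℝ) + 1 ≠ 0 := by positivity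
    simp only [Finset.sum_const, Finset.card_range, nsmul_eq_mul]
    push_cast
    field_simp
  linarith [mul_lt_mul_of_pos_left hlt hC, hsum (n + 1), hlb (n + 1)]

/-- Lower bound for a backtracked step length times the squared gradient norm `g ≤ 1`. -/
lemma mul_rpow_le_backtrack_step {α γ ρ g : ℝ} (hα : α ∈ Set.Ioo (0 : ℝ) 1) (hγ : 0 < γ)
    (hρ : 0 < ρ) (hg : 0 ≤ g) (hg1 : g ≤ 1) {j K : ℕ} (hj : j ≤ K) :
    α ^ K * γ * g ^ (2 + ρ * K) ≤ α ^ j * min 1 (g ^ (ρ * j)) * γ * g ^ 2 := by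
  have hpow : α ^ K ≤ α ^ j := pow_le_pow_of_le_one hα.1.le hα.2.le hj
  have hmin : g ^ (ρ * K) ≤ min 1 (g ^ (ρ * j)) :=
    le_min (Real.rpow_le_one hg hg1 (by positivity))
      (Real.rpow_le_rpow_of_exponent_ge' hg hg1 (by positivity) (by gcongr))
  have hα0 := hα.1
  calc α ^ K * γ * g ^ (2 + ρ * K) = α ^ K * g ^ (ρ * K) * γ * g ^ 2 := by
        rw [Real.rpow_add_of_nonneg hg (by norm_num) (by positivity), Real.rpow_two]
        ring
    _ ≤ α ^ j * min 1 (g ^ (ρ * j)) * γ * g ^ 2 := by gcongr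

/-- **Complexity of the Backtrack Hölder gradient method with uniformly bounded counters.** -/
theorem backtrack_holder_complexity {d : ℕ}
    (f : EuclideanSpace ℝ (Fin d) → ℝ) (hf : ContDiff ℝ 1 f)
    (δ α : ℝ) (hδ : δ ∈ Set.Ioo (0 : ℝ) 1) (hα : α ∈ Set.Ioo (0 : ℝ) 1)
    (γ ρ : ℝ) (hγ : 0 < γ) (hρ : 0 < ρ)
    (kbar : ℕ) (fs : ℝ)
    (x : ℕ → EuclideanSpace ℝ (Fin d)) (k : ℕ → ℕ) (hk : ∀ n, k n ≤ kbar)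
    (γn : ℕ → ℝ)
    (hγn : ∀ n, γn n = α ^ (k n) * min 1 (‖gradient f (x n)‖ ^ (ρ * (k n))) * γ)
    (hstep : ∀ n, x (n + 1) = x n - γn n • gradient f (x n))
    (hdesc : ∀ n, f (x (n + 1)) ≤ f (x n) - δ * γn n * ‖gradient f (x n)‖ ^ 2)
    (hlb : ∀ n, fs ≤ f (x n))
    (hsmall : ∀ n, ‖gradient f (x n)‖ ≤ 1) :
    (∀ n : ℕ, ∃ i ≤ n,
        ‖gradient f (x i)‖ ^ (2 + ρ * kbar)
          ≤ (f (x 0) - fs) / (δ * α ^ kbar * γ * ((n : ℝ) + 1))) ∧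
      ∃ c : ℝ, ∀ n : ℕ, ∃ i ≤ n,
        ‖gradient f (x i)‖ ≤ c * ((n : ℝ) + 1) ^ (-(1 / (2 + ρ * kbar))) := by
  have hα0 := hα.1
  have hδ0 := hδ.1
  have hC : 0 < δ * α ^ kbar * γ := by positivity
  have hp : 0 < 2 + ρ * (kbar : ℝ) := by positivity
  have hmain : ∀ n : ℕ, ∃ i ≤ n, ‖gradient f (x i)‖ ^ (2 + ρ * kbar)
      ≤ (f (x 0) - fs) / (δ * α ^ kbar * γ * ((n : ℝ) + 1)) := by
    refine exists_le_div_of_sufficient_decrease (F := fun n => f (x n))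
      (a := fun n => ‖gradient f (x n)‖ ^ (2 + ρ * kbar)) hC (fun n => ?_) hlb
    have hstep_lb := mul_le_mul_of_nonneg_left
      (mul_rpow_le_backtrack_step hα hγ hρ (norm_nonneg (gradient f (x n))) (hsmall n) (hk n))
      hδ0.le
    rw [← hγn n] at hstep_lb
    linarith [hdesc n]
  refine ⟨hmain, ((f (x 0) - fs) / (δ * α ^ kbar * γ)) ^ (1 / (2 + ρ * kbar)), fun n => ?_⟩
  obtain ⟨i, hi, hle⟩ := hmain n
  refine ⟨i, hi, ?_⟩
  have hgap : 0 ≤ (f (x 0) - fs) / (δ * α ^ kbar * γ) :=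
    div_nonneg (sub_nonneg.mpr (hlb 0)) hC.le
  have hn : (0 : ℝ) ≤ (n : ℝ) + 1 := by positivity
  rw [← div_div] at hle
  calc ‖gradient f (x i)‖
      = (‖gradient f (x i)‖ ^ (2 + ρ * kbar)) ^ (1 / (2 + ρ * kbar)) := by
        rw [one_div, Real.rpow_rpow_inv (norm_nonneg _) hp.ne']
    _ ≤ ((f (x 0) - fs) / (δ * α ^ kbar * γ) / ((n : ℝ) + 1)) ^ (1 / (2 + ρ * kbar)) := by
        gcongr
    _ = ((f (x 0) - fs) / (δ * α ^ kbar * γ)) ^ (1 / (2 + ρ * kbar))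
          * ((n : ℝ) + 1) ^ (-(1 / (2 + ρ * kbar))) := by
        rw [Real.div_rpow hgap hn, Real.rpow_neg hn, div_eq_mul_inv]
end

section
/- Let 𝒴 ⊆ ℝ^{d'} be nonempty and compact and L : ℝ^d × ℝ^{d'} → ℝ be C¹ such that for every x ∈ ℝ^d the set argmax_{y ∈ 𝒴} L(x, y) is a singleton {p(x)} with p continuous. Let g(x) := max_{y ∈ 𝒴} L(x,y); assume g is differentiable with ∇g(x) = ∇ₓL(x, p(x)) for all x, that ∇g is locally Hölder, and that g satisfies the Łojasiewicz inequality at every point of ℝ^d. Let δ, α ∈ (0,1) and γ, ρ > 0, and let (x_n), (y_n), (k_n) be generated by the monotone Backtrack Hölder min-max method: y_n = p(x_n); starting from k = k_{n−1} (k_{−1} = 0), k is incremented until, with γ_n = α^k min{1, ‖∇ₓL(x_n, y_n)‖^{ρk}} γ and x = x_n − γ_n ∇ₓL(x_n, y_n), one has L(x, p(x)) ≤ L(x_n, y_n) − δ γ_n ‖∇ₓL(x_n, y_n)‖²; then k_n = k, x_{n+1} = x, y_{n+1} = p(x). If (x_n) is bounded, then sup_n k_n < ∞, (x_n) converges to some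 x* ∈ ℝ^d, (y_n) converges to y* := p(x*) ∈ 𝒴, ∇ₓL(x*, y*) = 0, and y* is the unique maximizer of L(x*, ·) over 𝒴. -/
/-- Candidate step size of the Backtrack Hölder min-max method. -/
noncomputable def mmStep {d d' : ℕ}
    (Gx : EuclideanSpace ℝ (Fin d) → EuclideanSpace ℝ (Fin d') → EuclideanSpace ℝ (Fin d))
    (α ρ γ : ℝ) (x : EuclideanSpace ℝ (Fin d)) (y : EuclideanSpace ℝ (Fin d')) (j : ℕ) : ℝ :=
  α ^ j * min 1 (‖Gx x y‖ ^ (ρ * j)) * γ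

/-- Sufficient-decrease condition tested by the while-loop of the Backtrack Hölder min-max
method (the max-oracle value at the candidate point decreases sufficiently). -/
noncomputable def mmCond {d d' : ℕ}
    (L : EuclideanSpace ℝ (Fin d) → EuclideanSpace ℝ (Fin d') → ℝ)
    (Gx : EuclideanSpace ℝ (Fin d) → EuclideanSpace ℝ (Fin d') → EuclideanSpace ℝ (Fin d))
    (p : EuclideanSpace ℝ (Fin d) → EuclideanSpace ℝ (Fin d'))
    (δ α ρ γ : ℝ) (x : EuclideanSpace ℝ (Fin d)) (y : EuclideanSpace ℝ (Fin d'))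
    (j : ℕ) : Prop :=
  L (x - mmStep Gx α ρ γ x y j • Gx x y) (p (x - mmStep Gx α ρ γ x y j • Gx x y))
    ≤ L x y - δ * mmStep Gx α ρ γ x y j * ‖Gx x y‖ ^ 2

open Filter Topology

theorem mul_rpow_neg_mul_sub_le_rpow_sub_rpow {a b θ : ℝ} (ha : 0 < a) (hb : 0 ≤ b)
    (hθ : θ ∈ Set.Ioo (0 : ℝ) 1) :
    (1 - θ) * (a ^ (-θ) * (a - b)) ≤ a ^ (1 - θ) - b ^ (1 - θ) := by
  have h := rpow_one_add_le_one_add_mul_self (s := b / a - 1) (p := 1 - θ)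
    (by have := div_nonneg hb ha.le; linarith) (by linarith [hθ.2]) (by linarith [hθ.1])
  rw [add_sub_cancel, Real.div_rpow hb ha.le, div_le_iff₀ (Real.rpow_pos_of_pos ha _)] at h
  have e : a ^ (1 - θ) = a * a ^ (-θ) := by
    rw [sub_eq_add_neg, Real.rpow_add ha, Real.rpow_one]
  rw [e] at h ⊢
  have e2 : (1 + (1 - θ) * (b / a - 1)) * (a * a ^ (-θ))
      = a * a ^ (-θ) - (1 - θ) * (a ^ (-θ) * (a - b)) := by
    field_simp
    ring
  linarith

/-- A sequence satisfying the strong descent condition converges to each of its cluster points at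
which the Łojasiewicz inequality holds (Absil, Mahony and Andrews). -/
theorem tendsto_of_strong_descent_of_lojasiewicz {E : Type*} [NormedAddCommGroup E]
    {g : E → ℝ} {G : E → E} {x : ℕ → E} {z : E} {δ η C θ : ℝ} (hδ : 0 < δ)
    (hη : 0 < η) (hC : 0 < C) (hθ : θ ∈ Set.Ioo (0 : ℝ) 1)
    (hKL : ∀ u ∈ Metric.ball z η, C * |g u - g z| ^ θ ≤ ‖G u‖)
    (hdesc : ∀ n, δ * ‖x (n + 1) - x n‖ * ‖G (x n)‖ ≤ g (x n) - g (x (n + 1)))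
    (hstat : ∀ n, G (x n) = 0 → x (n + 1) = x n)
    (hlim : Tendsto (fun n => g (x n)) atTop (𝓝 (g z)))
    (hz : MapClusterPt z atTop x) : Tendsto x atTop (𝓝 z) := by
  have hanti : Antitone fun n => g (x n) := antitone_nat_of_succ_le fun n => by
    have := hdesc n
    have : 0 ≤ δ * ‖x (n + 1) - x n‖ * ‖G (x n)‖ := by positivity
    linarith
  have hge : ∀ n, g z ≤ g (x n) := fun n => hanti.le_of_tendsto hlim n
  set c := (1 - θ) * (δ * C) with hc
  have hθ1 : 0 < 1 - θ := by linarith [hθ.2]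
  have hcpos : 0 < c := by positivity
  set φ : ℕ → ℝ := fun n => (g (x n) - g z) ^ (1 - θ) with hφ
  have hφ0 : ∀ n, 0 ≤ φ n := fun n => Real.rpow_nonneg (by linarith [hge n]) _
  have hφlim : Tendsto φ atTop (𝓝 0) := by
    have h1 : Tendsto (fun n => g (x n) - g z) atTop (𝓝 0) := by
      simpa using hlim.sub_const (g z)
    have h2 := h1.rpow_const (p := 1 - θ) (Or.inr hθ1.le)
    rwa [Real.zero_rpow hθ1.ne'] at h2
  have hkey : ∀ n, x n ∈ Metric.ball z η → c * ‖x (n + 1) - x n‖ ≤ φ n - φ (n + 1) := by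
    intro n hn
    have hb : 0 ≤ g (x (n + 1)) - g z := by linarith [hge (n + 1)]
    have hd := hdesc n
    rcases (hge n).eq_or_lt with h0 | hpos
    · have h1 : g (x (n + 1)) = g (x n) :=
        le_antisymm (hanti n.le_succ) (h0 ▸ hge (n + 1))
      have h2 : δ * ‖x (n + 1) - x n‖ * ‖G (x n)‖ = 0 :=
        le_antisymm (by linarith) (by positivity)
      have h3 : ‖x (n + 1) - x n‖ = 0 := by
        rcases mul_eq_zero.1 h2 with h | h
        · exact (mul_eq_zero.1 h).resolve_left hδ.ne'
        · rw [hstat n (norm_eq_zero.1 h), sub_self, norm_zero]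
      simp [hφ, h1, h3]
    · have ha : 0 < g (x n) - g z := by linarith
      have hK := hKL _ hn
      rw [abs_of_pos ha] at hK
      have h1 := mul_rpow_neg_mul_sub_le_rpow_sub_rpow ha hb hθ
      have h2 : δ * ‖x (n + 1) - x n‖ * (C * (g (x n) - g z) ^ θ)
          ≤ (g (x n) - g z) - (g (x (n + 1)) - g z) := by
        have := mul_le_mul_of_nonneg_left hK
          (show 0 ≤ δ * ‖x (n + 1) - x n‖ by positivity)
        linarith
      have h3 : (g (x n) - g z) ^ (-θ) * (g (x n) - g z) ^ θ = 1 := by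
        rw [← Real.rpow_add ha, neg_add_cancel, Real.rpow_zero]
      have h4 := mul_le_mul_of_nonneg_left
        (mul_le_mul_of_nonneg_left h2 (Real.rpow_nonneg ha.le (-θ))) hθ1.le
      calc c * ‖x (n + 1) - x n‖
          = (1 - θ) * (δ * ‖x (n + 1) - x n‖ * C)
              * ((g (x n) - g z) ^ (-θ) * (g (x n) - g z) ^ θ) := by rw [h3, hc]; ring
        _ ≤ φ n - φ (n + 1) := by
            refine le_trans (le_of_eq ?_) (h4.trans h1)
            ring
  rw [Metric.tendsto_atTop]
  intro ε hε
  have hev : ∀ᶠ n in atTop, φ n / c < min ε η / 2 := by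
    have : Tendsto (fun n => φ n / c) atTop (𝓝 0) := by simpa using hφlim.div_const c
    exact this.eventually (gt_mem_nhds (by positivity))
  have hfr : ∃ᶠ n in atTop, x n ∈ Metric.ball z (min ε η / 2) :=
    hz.frequently (Metric.ball_mem_nhds z (by positivity))
  obtain ⟨N, hN1, hN2⟩ := (hfr.and_eventually hev).exists
  rw [Metric.mem_ball] at hN1
  have hinv : ∀ n ≥ N, dist (x n) z + φ n / c < min ε η := by
    intro n hn
    induction n, hn using Nat.le_induction with
    | base => linarith
    | succ n hn ih =>
      have hφn := div_nonneg (hφ0 n) hcpos.le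
      have hmem : x n ∈ Metric.ball z η := by
        rw [Metric.mem_ball]
        linarith [min_le_right ε η]
      have h1 : ‖x (n + 1) - x n‖ ≤ φ n / c - φ (n + 1) / c := by
        rw [← sub_div, le_div_iff₀ hcpos, mul_comm]
        exact hkey n hmem
      have h2 := dist_triangle (x (n + 1)) (x n) z
      rw [dist_eq_norm (x (n + 1)) (x n)] at h2
      linarith
  refine ⟨N, fun n hn => ?_⟩
  have hφn := div_nonneg (hφ0 n) hcpos.le
  linarith [hinv n hn, min_le_left ε η]

theorem le_of_hasGradientAt_of_holder {E : Type*} [NormedAddCommGroup E] [InnerProductSpace ℝ E]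
    [CompleteSpace E] {g : E → ℝ} {G : E → E} (hg : ∀ x, HasGradientAt g (G x) x)
    {V : Set E} (hV : Convex ℝ V) {β ν : ℝ} (hβ : 0 ≤ β) (hν : 0 ≤ ν)
    (hG : ∀ x ∈ V, ∀ x' ∈ V, ‖G x - G x'‖ ≤ β * ‖x - x'‖ ^ ν)
    {x : E} {s : ℝ} (hs : 0 ≤ s) (hx : x ∈ V) (hx' : x - s • G x ∈ V) :
    g (x - s • G x) ≤ g x - s * ‖G x‖ ^ 2 + β * (s * ‖G x‖) ^ ν * (s * ‖G x‖) := by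
  have hnorm : ‖x - s • G x - x‖ = s * ‖G x‖ := by
    rw [sub_sub_cancel_left, norm_neg, norm_smul, Real.norm_of_nonneg hs]
  have h := (convex_segment x (x - s • G x)).norm_image_sub_le_of_norm_hasFDerivWithin_le'
    (f := g) (f' := fun z => InnerProductSpace.toDual ℝ E (G z))
    (φ := InnerProductSpace.toDual ℝ E (G x)) (C := β * (s * ‖G x‖) ^ ν)
    (fun z _ => (hg z).hasFDerivAt.hasFDerivWithinAt)
    (fun z hz => by
      rw [← map_sub, LinearIsometryEquiv.norm_map]
      refine (hG z (hV.segment_subset hx hx' hz) x hx).trans ?_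
      have : ‖z - x‖ ≤ s * ‖G x‖ := by
        rw [← hnorm]
        exact norm_sub_le_of_mem_segment hz
      gcongr)
    (left_mem_segment ℝ _ _) (right_mem_segment ℝ _ _)
  rw [hnorm, sub_sub_cancel_left, InnerProductSpace.toDual_apply_apply, inner_neg_right,
    inner_smul_right, real_inner_self_eq_norm_sq] at h
  have := (le_abs_self _).trans h
  linarith

theorem exists_backtrack_index (β : ℝ) {ν δ α γ ρ : ℝ} (hν : ν ∈ Set.Ioc (0 : ℝ) 1)
    (hδ : δ < 1) (hα : α ∈ Set.Ioo (0 : ℝ) 1) (hγ : 0 < γ) (hρ : 0 < ρ) :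
    ∃ J : ℕ, ∀ t : ℝ, 0 < t →
      β * (α ^ J * min 1 (t ^ (ρ * J)) * γ * t) ^ ν ≤ (1 - δ) * t := by
  have h1 : ∀ᶠ J : ℕ in atTop, β * (α ^ J * γ) ^ ν < 1 - δ := by
    have h := (((tendsto_pow_atTop_nhds_zero_of_lt_one hα.1.le hα.2).mul_const γ).rpow_const
      (p := ν) (Or.inr hν.1.le)).const_mul β
    rw [zero_mul, Real.zero_rpow hν.1.ne', mul_zero] at h
    exact h.eventually (gt_mem_nhds (by linarith))
  have h2 : ∀ᶠ J : ℕ in atTop, 1 / (ν * ρ) ≤ (J : ℝ) :=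
    tendsto_natCast_atTop_atTop.eventually_ge_atTop _
  obtain ⟨J, hJ1, hJ2⟩ := (h1.and h2).exists
  have hν0 := hν.1
  have hα0 := hα.1
  have hexp : 1 ≤ (ρ * J + 1) * ν := by
    rw [div_le_iff₀ (by positivity)] at hJ2
    nlinarith
  refine ⟨J, fun t ht => ?_⟩
  have hm : 0 ≤ min 1 (t ^ (ρ * J)) := le_min zero_le_one (by positivity)
  have hle : (min 1 (t ^ (ρ * J)) * t) ^ ν ≤ t := by
    rcases le_total 1 t with h | h
    · calc (min 1 (t ^ (ρ * J)) * t) ^ ν ≤ (1 * t) ^ ν := by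
            gcongr
            exact min_le_left _ _
        _ ≤ t := by
            rw [one_mul]
            simpa using Real.rpow_le_rpow_of_exponent_le h hν.2
    · calc (min 1 (t ^ (ρ * J)) * t) ^ ν ≤ (t ^ (ρ * J) * t) ^ ν := by
            gcongr
            exact min_le_right _ _
        _ = t ^ ((ρ * J + 1) * ν) := by
            rw [Real.rpow_mul ht.le (ρ * J + 1), Real.rpow_add ht, Real.rpow_one]
        _ ≤ t := by
            simpa using Real.rpow_le_rpow_of_exponent_ge ht h hexp
  calc β * (α ^ J * min 1 (t ^ (ρ * J)) * γ * t) ^ ν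
      = β * (α ^ J * γ) ^ ν * (min 1 (t ^ (ρ * J)) * t) ^ ν := by
        rw [mul_assoc β, ← Real.mul_rpow (by positivity) (by positivity)]
        ring_nf
    _ ≤ (1 - δ) * t := by gcongr

theorem mmStep_nonneg {d d' : ℕ}
    (Gx : EuclideanSpace ℝ (Fin d) → EuclideanSpace ℝ (Fin d') → EuclideanSpace ℝ (Fin d))
    {α ρ γ : ℝ} (hα : 0 ≤ α) (hγ : 0 ≤ γ) (x : EuclideanSpace ℝ (Fin d))
    (y : EuclideanSpace ℝ (Fin d')) (j : ℕ) : 0 ≤ mmStep Gx α ρ γ x y j := by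
  have : 0 ≤ min 1 (‖Gx x y‖ ^ (ρ * j)) := le_min zero_le_one (by positivity)
  unfold mmStep
  positivity

theorem mmStep_le {d d' : ℕ}
    (Gx : EuclideanSpace ℝ (Fin d) → EuclideanSpace ℝ (Fin d') → EuclideanSpace ℝ (Fin d))
    {α ρ γ : ℝ} (hα : α ∈ Set.Ioo (0 : ℝ) 1) (hγ : 0 ≤ γ) (x : EuclideanSpace ℝ (Fin d))
    (y : EuclideanSpace ℝ (Fin d')) (j : ℕ) : mmStep Gx α ρ γ x y j ≤ γ := by
  have h0 : 0 ≤ min 1 (‖Gx x y‖ ^ (ρ * j)) := le_min zero_le_one (by positivity)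
  have h1 : α ^ j * min 1 (‖Gx x y‖ ^ (ρ * j)) ≤ 1 :=
    mul_le_one₀ (pow_le_one₀ hα.1.le hα.2.le) h0 (min_le_left _ _)
  exact mul_le_of_le_one_left hγ h1

/-- On a bounded set some backtracking index is accepted at every point. -/
theorem exists_forall_mmCond {d d' : ℕ}
    {L : EuclideanSpace ℝ (Fin d) → EuclideanSpace ℝ (Fin d') → ℝ}
    {p : EuclideanSpace ℝ (Fin d) → EuclideanSpace ℝ (Fin d')}
    {g : EuclideanSpace ℝ (Fin d) → ℝ} (hgdef : ∀ x, g x = L x (p x))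
    {Gx : EuclideanSpace ℝ (Fin d) → EuclideanSpace ℝ (Fin d') → EuclideanSpace ℝ (Fin d)}
    (hgdiff : ∀ x, HasGradientAt g (Gx x (p x)) x)
    (hgH : ∀ V : Set (EuclideanSpace ℝ (Fin d)), Bornology.IsBounded V →
      ∃ β > (0 : ℝ), ∃ ν ∈ Set.Ioc (0 : ℝ) 1,
        ∀ x ∈ V, ∀ x' ∈ V, ‖Gx x (p x) - Gx x' (p x')‖ ≤ β * ‖x - x'‖ ^ ν)
    {δ α γ ρ : ℝ} (hδ : δ < 1) (hα : α ∈ Set.Ioo (0 : ℝ) 1) (hγ : 0 < γ) (hρ : 0 < ρ)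
    {S : Set (EuclideanSpace ℝ (Fin d))} (hS : Bornology.IsBounded S) :
    ∃ J : ℕ, ∀ u ∈ S, mmCond L Gx p δ α ρ γ u (p u) J := by
  obtain ⟨R, hR⟩ := (Metric.isBounded_iff_subset_closedBall 0).1 hS
  obtain ⟨M, hM0, hM⟩ : ∃ M : ℝ, 0 ≤ M ∧ ∀ u ∈ S, ‖Gx u (p u)‖ ≤ M := by
    obtain ⟨β, hβ, ν, hν, h⟩ := hgH (insert 0 S) (hS.insert 0)
    refine ⟨‖Gx 0 (p 0)‖ + β * |R| ^ ν, by positivity, fun u hu => ?_⟩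
    have h1 := h u (Set.mem_insert_of_mem _ hu) 0 (Set.mem_insert _ _)
    have h2 : ‖u - 0‖ ≤ |R| := by
      have := hR hu
      rw [mem_closedBall_iff_norm] at this
      exact this.trans (le_abs_self R)
    have h3 : β * ‖u - 0‖ ^ ν ≤ β * |R| ^ ν := by
      have := hν.1
      gcongr
    linarith [norm_le_norm_add_norm_sub' (Gx u (p u)) (Gx 0 (p 0))]
  obtain ⟨β, hβ, ν, hν, hH⟩ := hgH (Metric.closedBall 0 (R + γ * M)) Metric.isBounded_closedBall
  obtain ⟨J, hJ⟩ := exists_backtrack_index β hν hδ hα hγ hρ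
  refine ⟨J, fun u hu => ?_⟩
  have hs0 := mmStep_nonneg Gx (ρ := ρ) hα.1.le hγ.le u (p u) J
  have hs1 := mmStep_le Gx (ρ := ρ) hα hγ.le u (p u) J
  have hsJ : mmStep Gx α ρ γ u (p u) J = α ^ J * min 1 (‖Gx u (p u)‖ ^ (ρ * J)) * γ := rfl
  unfold mmCond
  rw [← hgdef, ← hgdef]
  set s := mmStep Gx α ρ γ u (p u) J
  have huR : ‖u‖ ≤ R := by simpa using hR hu
  have hsM : ‖s • Gx u (p u)‖ ≤ γ * M := by
    rw [norm_smul, Real.norm_of_nonneg hs0]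
    exact mul_le_mul hs1 (hM u hu) (norm_nonneg _) hγ.le
  have h := le_of_hasGradientAt_of_holder hgdiff (convex_closedBall 0 (R + γ * M)) hβ.le hν.1.le
    hH hs0 (x := u) (by rw [mem_closedBall_zero_iff]; nlinarith)
    (by rw [mem_closedBall_zero_iff]; linarith [norm_sub_le u (s • Gx u (p u))])
  refine h.trans ?_
  rcases (norm_nonneg (Gx u (p u))).eq_or_lt with h0 | hpos
  · simp [← h0]
  · have h1 := hJ _ hpos
    rw [← hsJ] at h1
    have h2 := mul_le_mul_of_nonneg_right h1 (mul_nonneg hs0 hpos.le)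
    linarith

/-- **Convergence of the monotone Backtrack Hölder min-max method.** -/
theorem backtrack_holder_minmax {d d' : ℕ}
    (Y : Set (EuclideanSpace ℝ (Fin d'))) (hYne : Y.Nonempty) (hYcomp : IsCompact Y)
    (L : EuclideanSpace ℝ (Fin d) → EuclideanSpace ℝ (Fin d') → ℝ)
    (hL : ContDiff ℝ 1 fun q : EuclideanSpace ℝ (Fin d) × EuclideanSpace ℝ (Fin d') =>
      L q.1 q.2)
    (p : EuclideanSpace ℝ (Fin d) → EuclideanSpace ℝ (Fin d'))
    (hp : ∀ x, {y | y ∈ Y ∧ ∀ z ∈ Y, L x z ≤ L x y} = {p x})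
    (hpcont : Continuous p)
    (g : EuclideanSpace ℝ (Fin d) → ℝ) (hgdef : ∀ x, g x = L x (p x))
    (Gx : EuclideanSpace ℝ (Fin d) → EuclideanSpace ℝ (Fin d') → EuclideanSpace ℝ (Fin d))
    (hGx : ∀ x y, HasGradientAt (fun x' => L x' y) (Gx x y) x)
    (hgdiff : ∀ x, HasGradientAt g (Gx x (p x)) x)
    (hgH : ∀ V : Set (EuclideanSpace ℝ (Fin d)), Bornology.IsBounded V →
      ∃ β > (0 : ℝ), ∃ ν ∈ Set.Ioc (0 : ℝ) 1,
        ∀ x ∈ V, ∀ x' ∈ V, ‖Gx x (p x) - Gx x' (p x')‖ ≤ β * ‖x - x'‖ ^ ν)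
    (hKL : ∀ x₀ : EuclideanSpace ℝ (Fin d), ∃ η > (0 : ℝ), ∃ C > (0 : ℝ),
      ∃ θ ∈ Set.Ioo (0 : ℝ) 1,
        ∀ x ∈ Metric.ball x₀ η, C * |g x - g x₀| ^ θ ≤ ‖Gx x (p x)‖)
    (δ α : ℝ) (hδ : δ ∈ Set.Ioo (0 : ℝ) 1) (hα : α ∈ Set.Ioo (0 : ℝ) 1)
    (γ ρ : ℝ) (hγ : 0 < γ) (hρ : 0 < ρ)
    (x : ℕ → EuclideanSpace ℝ (Fin d)) (y : ℕ → EuclideanSpace ℝ (Fin d')) (k : ℕ → ℕ)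
    (hy : ∀ n, y n = p (x n))
    (hcond : ∀ n, mmCond L Gx p δ α ρ γ (x n) (y n) (k n))
    (hmin0 : ∀ j, j < k 0 → ¬ mmCond L Gx p δ α ρ γ (x 0) (y 0) j)
    (hmono : ∀ n, k n ≤ k (n + 1))
    (hmin : ∀ n j, k n ≤ j → j < k (n + 1) → ¬ mmCond L Gx p δ α ρ γ (x (n + 1)) (y (n + 1)) j)
    (hstep : ∀ n, x (n + 1) = x n - mmStep Gx α ρ γ (x n) (y n) (k n) • Gx (x n) (y n))
    (hbdd : Bornology.IsBounded (Set.range x)) :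
    (∃ K : ℕ, ∀ n, k n ≤ K) ∧
      ∃ xs : EuclideanSpace ℝ (Fin d),
        Filter.Tendsto x Filter.atTop (nhds xs) ∧
        Filter.Tendsto y Filter.atTop (nhds (p xs)) ∧
        Gx xs (p xs) = 0 ∧
        p xs ∈ Y ∧ (∀ z ∈ Y, L xs z ≤ L xs (p xs)) ∧
        ∀ z ∈ Y, (∀ w ∈ Y, L xs w ≤ L xs z) → z = p xs := by
  obtain ⟨J, hJ⟩ := exists_forall_mmCond hgdef hgdiff hgH hδ.2 hα hγ hρ hbdd
  have hJ' : ∀ n, mmCond L Gx p δ α ρ γ (x n) (y n) J := fun n => by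
    rw [hy]
    exact hJ _ (Set.mem_range_self n)
  have hk : ∀ n, k n ≤ J := by
    intro n
    induction n with
    | zero => exact not_lt.1 fun h => hmin0 J h (hJ' 0)
    | succ n ih => exact not_lt.1 fun h => hmin n J ih h (hJ' (n + 1))
  refine ⟨⟨J, hk⟩, ?_⟩
  set s : ℕ → ℝ := fun n => mmStep Gx α ρ γ (x n) (y n) (k n) with hs
  have hs0 : ∀ n, 0 ≤ s n := fun n => mmStep_nonneg Gx hα.1.le hγ.le _ _ _
  have hdec : ∀ n, g (x (n + 1)) ≤ g (x n) - δ * s n * ‖Gx (x n) (p (x n))‖ ^ 2 := by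
    intro n
    have h := hcond n
    unfold mmCond at h
    rw [← hstep n, hy n, ← hgdef, ← hgdef, ← hy n] at h
    rw [← hy n]
    exact h
  have hnorm : ∀ n, ‖x (n + 1) - x n‖ = s n * ‖Gx (x n) (p (x n))‖ := by
    intro n
    rw [hstep n, sub_sub_cancel_left, norm_neg, norm_smul, Real.norm_of_nonneg (hs0 n), ← hy n]
  have hGcont : Continuous fun u => Gx u (p u) := by
    rw [continuous_iff_continuousAt]
    intro u
    obtain ⟨β, -, ν, hν, h⟩ := hgH (Metric.ball u 1) Metric.isBounded_ball
    have h0 : Tendsto (fun v => β * ‖v - u‖ ^ ν) (𝓝 u) (𝓝 0) := by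
      have : Tendsto (fun v => ‖v - u‖) (𝓝 u) (𝓝 0) := tendsto_norm_sub_self u
      have := (this.rpow_const (p := ν) (Or.inr hν.1.le)).const_mul β
      rwa [Real.zero_rpow hν.1.ne', mul_zero] at this
    rw [ContinuousAt, tendsto_iff_norm_sub_tendsto_zero]
    refine squeeze_zero' (Eventually.of_forall fun _ => norm_nonneg _) ?_ h0
    filter_upwards [Metric.ball_mem_nhds u one_pos] with v hv
    exact h v hv u (Metric.mem_ball_self one_pos)
  have hgcont : Continuous g := continuous_iff_continuousAt.2 fun u => (hgdiff u).continuousAt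
  obtain ⟨xs, -, ψ, hψ, hψlim⟩ := tendsto_subseq_of_bounded hbdd fun n => Set.mem_range_self n
  have hanti : Antitone fun n => g (x n) := antitone_nat_of_succ_le fun n => by
    have := mul_nonneg (mul_nonneg hδ.1.le (hs0 n)) (sq_nonneg ‖Gx (x n) (p (x n))‖)
    linarith [hdec n]
  have hlim : Tendsto (fun n => g (x n)) atTop (𝓝 (g xs)) :=
    (tendsto_iff_tendsto_subseq_of_antitone hanti hψ.tendsto_atTop).2
      ((hgcont.tendsto xs).comp hψlim)
  obtain ⟨η, hη, C, hC, θ, hθ, hK⟩ := hKL xs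
  have hconv : Tendsto x atTop (𝓝 xs) := by
    refine tendsto_of_strong_descent_of_lojasiewicz (G := fun u => Gx u (p u)) hδ.1 hη hC hθ hK
      (fun n => ?_) (fun n hn => ?_) hlim (hψlim.mapClusterPt.of_comp hψ.tendsto_atTop)
    · rw [hnorm]
      linarith [hdec n]
    · rw [hstep n, hy n, hn, smul_zero, sub_zero]
  have hpxs : p xs ∈ Y ∧ ∀ z ∈ Y, L xs z ≤ L xs (p xs) := (hp xs).ge rfl
  refine ⟨xs, hconv, ?_, ?_, hpxs.1, hpxs.2, fun z hz hzmax => (hp xs).le ⟨hz, hzmax⟩⟩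
  · rw [funext hy]
    exact (hpcont.tendsto xs).comp hconv
  · by_contra hne
    set t : ℝ := ‖Gx xs (p xs)‖
    have ht : 0 < t := norm_pos_iff.2 hne
    have htlim : Tendsto (fun n => ‖Gx (x n) (p (x n))‖) atTop (𝓝 t) :=
      (hGcont.norm.tendsto xs).comp hconv
    have hlow : Tendsto (fun n => δ * (α ^ J * min 1 (‖Gx (x n) (p (x n))‖ ^ (ρ * J)) * γ)
        * ‖Gx (x n) (p (x n))‖ ^ 2) atTop (𝓝 (δ * (α ^ J * min 1 (t ^ (ρ * J)) * γ) * t ^ 2)) :=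
      ((((tendsto_const_nhds.min (htlim.rpow_const (Or.inl ht.ne'))).const_mul _).mul_const
        _).const_mul _).mul (htlim.pow 2)
    have hup : Tendsto (fun n => g (x n) - g (x (n + 1))) atTop (𝓝 0) := by
      simpa using hlim.sub ((tendsto_add_atTop_iff_nat 1).2 hlim)
    have hle : δ * (α ^ J * min 1 (t ^ (ρ * J)) * γ) * t ^ 2 ≤ 0 := by
      refine le_of_tendsto_of_tendsto' hlow hup fun n => ?_
      set r : ℝ := ‖Gx (x n) (p (x n))‖
      have hr : 0 ≤ r := norm_nonneg _
      have hstepn : s n = α ^ k n * min 1 (r ^ (ρ * k n)) * γ := by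
        simp only [hs, mmStep, hy n, r]
      have hmin' : min 1 (r ^ (ρ * J)) ≤ min 1 (r ^ (ρ * k n)) := by
        refine le_min (min_le_left _ _) ?_
        rcases le_total 1 r with h | h
        · exact (min_le_left _ _).trans (Real.one_le_rpow h (by positivity))
        · refine (min_le_right _ _).trans ?_
          have hkn : (k n : ℝ) ≤ J := by exact_mod_cast hk n
          exact Real.rpow_le_rpow_of_exponent_ge' hr h (by positivity) (by gcongr)
      have hsn : α ^ J * min 1 (r ^ (ρ * J)) * γ ≤ s n := by
        rw [hstepn]
        have h0 : 0 ≤ min 1 (r ^ (ρ * J)) := le_min zero_le_one (by positivity)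
        have h1 : α ^ J ≤ α ^ k n := pow_le_pow_of_le_one hα.1.le hα.2.le (hk n)
        have := pow_nonneg hα.1.le (k n)
        gcongr
      have h3 : δ * (α ^ J * min 1 (r ^ (ρ * J)) * γ) * r ^ 2 ≤ δ * s n * r ^ 2 := by
        have := hδ.1
        gcongr
      linarith [hdec n]
    have hpos : 0 < min 1 (t ^ (ρ * J)) := lt_min one_pos (by positivity)
    have hδ0 := hδ.1
    have hα0 := hα.1
    exact absurd hle (not_le.2 (by positivity))
end
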